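/- arXiv:2310.02064 — 8 statements merged into one kernel-verified Lean document; each statement's English description precedes it below -/
import Mathlib

section
/- If a mechanism (x, p) for a single ex post ROI-constrained bidder is DSIC and IR, then the allocation rule x is monotonically non-decreasing: for all v, v' ∈ [0, v_max] with v < v', one has x(v) ≤ x(v'). -/
open Set MeasureTheory

/-- Myerson payment of an allocation rule `x`: `p̃(v) = v·x(v) − ∫₀^v x(z) dz`. -/
noncomputable def myersonPayment (x : ℝ → ℝ) (v : ℝ) : ℝ :=
  v * x v - ∫ z in (0:ℝ)..v, x z

/-- ROI payment rule associated with allocation `x` and ROI parameter `M`: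
`p(v) = M·p̃(v) − max_{0 ≤ z ≤ v} (M·p̃(z) − z·x(z))`. -/
noncomputable def roiPayment (M : ℝ) (x : ℝ → ℝ) (v : ℝ) : ℝ :=
  M * myersonPayment x v -
    sSup ((fun z => M * myersonPayment x z - z * x z) '' Set.Icc 0 v)

/-- Utility of a bidder with value `v` who bids `b`: `M·v·x(b) − p(b)` if the
ex post ROI (IR) condition `p(b) ≤ v·x(b)` holds, and `−∞` otherwise. -/
noncomputable def utility (M : ℝ) (x p : ℝ → ℝ) (b v : ℝ) : EReal :=
  if p b ≤ v * x b then ((M * v * x b - p b : ℝ) : EReal) else ⊥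

/-- Dominant-strategy incentive compatibility. -/
def DSIC (M vmax : ℝ) (x p : ℝ → ℝ) : Prop :=
  ∀ v ∈ Set.Icc (0:ℝ) vmax, ∀ b ∈ Set.Icc (0:ℝ) vmax,
    utility M x p b v ≤ utility M x p v v

/-- Individual rationality. -/
def IR (M vmax : ℝ) (x p : ℝ → ℝ) : Prop :=
  ∀ v ∈ Set.Icc (0:ℝ) vmax, (0 : EReal) ≤ utility M x p v v

/-- The allocation rule is right-differentiable on `[0, vmax]` with finitely many
non-differentiable points. -/
def RightDiffFin (vmax : ℝ) (x : ℝ → ℝ) : Prop :=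
  ∃ s : Finset ℝ, ∀ v ∈ Set.Icc (0:ℝ) vmax, v ∉ s →
    DifferentiableWithinAt ℝ x (Set.Ici v) v

theorem utility_of_le {M : ℝ} {x p : ℝ → ℝ} {b v : ℝ} (h : p b ≤ v * x b) :
    utility M x p b v = ((M * v * x b - p b : ℝ) : EReal) := if_pos h

theorem IR.payment_le {M vmax : ℝ} {x p : ℝ → ℝ} (hir : IR M vmax x p) {v : ℝ}
    (hv : v ∈ Set.Icc (0:ℝ) vmax) : p v ≤ v * x v := by
  by_contra h
  have := hir v hv
  simp [utility, h] at this

theorem DSIC.real_utility_le {M vmax : ℝ} {x p : ℝ → ℝ} (hdsic : DSIC M vmax x p)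
    (hir : IR M vmax x p) {v b : ℝ} (hv : v ∈ Set.Icc (0:ℝ) vmax)
    (hb : b ∈ Set.Icc (0:ℝ) vmax) (h : p b ≤ v * x b) :
    M * v * x b - p b ≤ M * v * x v - p v := by
  have := hdsic v hv b hb
  rwa [utility_of_le h, utility_of_le (hir.payment_le hv), EReal.coe_le_coe_iff] at this

/-- if a mechanism for a single ex post ROI-constrained bidder is
DSIC and IR, then the allocation rule is monotonically non-decreasing. -/
theorem monotone_allocation_of_dsic (vmax M : ℝ) (hvmax : 0 < vmax) (hM : 1 < M)
    (x p : ℝ → ℝ)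
    (hx0 : x 0 = 0) (hxrange : ∀ v ∈ Set.Icc (0:ℝ) vmax, x v ∈ Set.Icc (0:ℝ) 1)
    (hp0 : p 0 = 0)
    (hdsic : DSIC M vmax x p) (hir : IR M vmax x p) :
    ∀ v ∈ Set.Icc (0:ℝ) vmax, ∀ v' ∈ Set.Icc (0:ℝ) vmax, v < v' → x v ≤ x v' := by
  intro v hv v' hv' hlt
  by_contra! hx
  have hpv := hir.payment_le hv
  have hd : 0 < x v - x v' := sub_pos.mpr hx
  have hxv := (hxrange v hv).1
  have hup := hdsic.real_utility_le hir hv' hv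
    (hpv.trans (mul_le_mul_of_nonneg_right hlt.le hxv))
  have hgap : v * (x v - x v') < v' * (x v - x v') := mul_lt_mul_of_pos_right hlt hd
  rcases le_or_gt (p v') (v * x v') with h | h
  · have hdown := hdsic.real_utility_le hir hv hv' h
    nlinarith [mul_lt_mul_of_pos_left hgap (zero_lt_one.trans hM)]
  · have hpos : 0 < v' * (x v - x v') := mul_pos (hv.1.trans_lt hlt) hd
    nlinarith [mul_lt_mul_of_pos_right hM hpos]
end

section
/- Let x : [0, v_max] → [0, 1] be monotonically non-decreasing with x(0) = 0, let p̃ be the Myerson payment of x, and let p be the ROI payment rule associated with x. Suppose 0 ≤ v < v' ≤ v_max and there exists v* with v < v* ≤ v' such that v* attains max_{0 ≤ z ≤ v'} (M·p̃(z) − z·x(z)) and M·p̃(v*) − v*·x(v*) > max_{0 ≤ z ≤ v} (M·p̃(z) − z·x(z)). Then p(v') ≥ v*·x(v') > v·x(v'); in particular, a bidder with value v who misreports v' violates individual rationality. -/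
open Set MeasureTheory

/-- The Myerson payment increases by at least `a·(x(b) − x(a))` between `a` and `b`. -/
theorem mul_sub_le_myersonPayment_sub {x : ℝ → ℝ} {a b : ℝ} (ha : 0 ≤ a) (hab : a ≤ b)
    (hmono : MonotoneOn x (Set.Icc 0 b)) :
    a * (x b - x a) ≤ myersonPayment x b - myersonPayment x a := by
  have hint {c d : ℝ} (hc : 0 ≤ c) (hcd : c ≤ d) (hd : d ≤ b) :
      IntervalIntegrable x volume c d :=
    MonotoneOn.intervalIntegrable
      (hmono.mono (by rw [Set.uIcc_of_le hcd]; exact Set.Icc_subset_Icc hc hd))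
  have hadd := intervalIntegral.integral_add_adjacent_intervals
    (hint le_rfl ha hab) (hint ha hab le_rfl)
  have hle : ∫ z in a..b, x z ≤ ∫ _ in a..b, x b :=
    intervalIntegral.integral_mono_on hab (hint ha hab le_rfl) intervalIntegrable_const
      fun z hz => hmono ⟨ha.trans hz.1, hz.2⟩ ⟨ha.trans hab, le_rfl⟩ hz.2
  rw [intervalIntegral.integral_const, smul_eq_mul] at hle
  unfold myersonPayment
  linarith

/-- if the maximum in the ROI payment over `[0, v']` is attained at
some `v* > v` and strictly exceeds the maximum over `[0, v]`, then the payment at a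
report of `v'` exceeds the value `v·x(v')` obtained by a bidder with true value `v`,
violating individual rationality for the upward misreport. -/
theorem upward_misreport_violates_ir (vmax M : ℝ) (hvmax : 0 < vmax) (hM : 1 < M)
    (x : ℝ → ℝ)
    (hx0 : x 0 = 0) (hxrange : ∀ w ∈ Set.Icc (0:ℝ) vmax, x w ∈ Set.Icc (0:ℝ) 1)
    (hmono : MonotoneOn x (Set.Icc 0 vmax))
    (v v' vstar : ℝ)
    (hv : 0 ≤ v) (hvv' : v < v') (hv' : v' ≤ vmax)
    (hvstar : v < vstar) (hvstar' : vstar ≤ v')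
    (hattain : M * myersonPayment x vstar - vstar * x vstar =
      sSup ((fun z => M * myersonPayment x z - z * x z) '' Set.Icc 0 v'))
    (hstrict : sSup ((fun z => M * myersonPayment x z - z * x z) '' Set.Icc 0 v) <
      M * myersonPayment x vstar - vstar * x vstar) :
    vstar * x v' ≤ roiPayment M x v' ∧ v * x v' < vstar * x v' := by
  have hvs : 0 < vstar := hv.trans_lt hvstar
  have hv'0 : 0 ≤ v' := hvs.le.trans hvstar'
  have hxle : x vstar ≤ x v' := hmono ⟨hvs.le, hvstar'.trans hv'⟩ ⟨hv'0, hv'⟩ hvstar'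
  refine ⟨?_, mul_lt_mul_of_pos_right hvstar ?_⟩
  · have hpay := mul_sub_le_myersonPayment_sub hvs.le hvstar'
      (hmono.mono (Set.Icc_subset_Icc_right hv'))
    have hnonneg : 0 ≤ vstar * (x v' - x vstar) := mul_nonneg hvs.le (sub_nonneg.2 hxle)
    rw [roiPayment, ← hattain]
    nlinarith [mul_le_mul_of_nonneg_left hpay (zero_le_one.trans hM.le),
      mul_nonneg (sub_nonneg.2 hM.le) hnonneg]
  · by_contra! hle
    have hsup : 0 ≤ sSup ((fun z => M * myersonPayment x z - z * x z) '' Set.Icc 0 v) :=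
      Real.sSup_nonneg' ⟨0, ⟨0, ⟨le_rfl, hv⟩, by simp [myersonPayment]⟩, le_rfl⟩
    have hxs : x vstar = 0 :=
      le_antisymm (hxle.trans hle) (hxrange vstar ⟨hvs.le, hvstar'.trans hv'⟩).1
    have hint : 0 ≤ ∫ z in (0:ℝ)..vstar, x z :=
      intervalIntegral.integral_nonneg hvs.le fun z hz =>
        (hxrange z ⟨hz.1, hz.2.trans (hvstar'.trans hv')⟩).1
    rw [myersonPayment, hxs] at hstrict
    nlinarith [mul_nonneg (zero_le_one.trans hM.le) hint]
end

section
/- Let x : [0, v_max] → [0, 1] be monotonically non-decreasing with x(0) = 0, and let p be the ROI payment rule associated with x. Then p is monotonically non-decreasing: for all v, v' ∈ [0, v_max] with v < v', one has p(v) ≤ p(v'). -/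
open Set MeasureTheory

theorem myersonPayment_le_of_monotoneOn {x : ℝ → ℝ} {a b : ℝ} (ha : 0 ≤ a) (hab : a ≤ b)
    (hmono : MonotoneOn x (Set.Icc 0 b)) : myersonPayment x a ≤ myersonPayment x b := by
  have hI : ∀ c ∈ Set.Icc 0 b, ∀ d ∈ Set.Icc 0 b, IntervalIntegrable x volume c d :=
    fun c hc d hd => (hmono.mono (Set.uIcc_subset_Icc hc hd)).intervalIntegrable
  have h0 : (0:ℝ) ∈ Set.Icc 0 b := ⟨le_rfl, ha.trans hab⟩
  have ha' : a ∈ Set.Icc 0 b := ⟨ha, hab⟩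
  have hb : b ∈ Set.Icc 0 b := ⟨ha.trans hab, le_rfl⟩
  have hsplit := intervalIntegral.integral_add_adjacent_intervals (hI 0 h0 a ha') (hI a ha' b hb)
  have hle : ∫ z in a..b, x z ≤ (b - a) * x b := by
    calc ∫ z in a..b, x z ≤ ∫ _ in a..b, x b :=
          intervalIntegral.integral_mono_on hab (hI a ha' b hb) intervalIntegrable_const
            fun z hz => hmono ⟨ha.trans hz.1, hz.2⟩ hb hz.2
      _ = (b - a) * x b := by simp
  have hx : a * x a ≤ a * x b := mul_le_mul_of_nonneg_left (hmono ha' hb hab) ha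
  unfold myersonPayment
  linarith

/-- Proposition 1, part 2: the ROI payment rule is monotonically
non-decreasing. -/
theorem roiPayment_monotone (vmax M : ℝ) (hvmax : 0 < vmax) (hM : 1 < M)
    (x : ℝ → ℝ)
    (hx0 : x 0 = 0) (hxrange : ∀ w ∈ Set.Icc (0:ℝ) vmax, x w ∈ Set.Icc (0:ℝ) 1)
    (hmono : MonotoneOn x (Set.Icc 0 vmax)) :
    ∀ v ∈ Set.Icc (0:ℝ) vmax, ∀ v' ∈ Set.Icc (0:ℝ) vmax, v < v' →
      roiPayment M x v ≤ roiPayment M x v' := by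
  intro v hv v' hv' hlt
  have hM0 : 0 ≤ M := by linarith
  have hpay : ∀ a b, 0 ≤ a → a ≤ b → b ≤ vmax →
      M * myersonPayment x a ≤ M * myersonPayment x b := fun a b ha hab hb =>
    mul_le_mul_of_nonneg_left (myersonPayment_le_of_monotoneOn ha hab
      (hmono.mono (Set.Icc_subset_Icc_right hb))) hM0
  have hbdd : BddAbove ((fun z => M * myersonPayment x z - z * x z) '' Set.Icc 0 v) := by
    refine ⟨M * myersonPayment x v, ?_⟩
    rintro _ ⟨z, hz, rfl⟩
    have hzx : 0 ≤ z * x z := mul_nonneg hz.1 (hxrange z ⟨hz.1, hz.2.trans hv.2⟩).1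
    have := hpay z v hz.1 hz.2 hv.2
    dsimp only
    linarith
  have hsup : sSup ((fun z => M * myersonPayment x z - z * x z) '' Set.Icc 0 v') ≤
      sSup ((fun z => M * myersonPayment x z - z * x z) '' Set.Icc 0 v) +
        (M * myersonPayment x v' - M * myersonPayment x v) := by
    refine csSup_le ((Set.nonempty_Icc.2 hv'.1).image _) ?_
    rintro _ ⟨z, hz, rfl⟩
    dsimp only
    rcases le_total z v with hzv | hvz
    · have h₁ := le_csSup hbdd (Set.mem_image_of_mem _ (⟨hz.1, hzv⟩ : z ∈ Set.Icc 0 v))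
      have h₂ := hpay v v' hv.1 hlt.le hv'.2
      linarith
    · have hzmax : z ∈ Set.Icc 0 vmax := ⟨hz.1, hz.2.trans hv'.2⟩
      have h₁ := le_csSup hbdd (Set.mem_image_of_mem _ (⟨hv.1, le_rfl⟩ : v ∈ Set.Icc 0 v))
      have h₂ := hpay z v' hz.1 hz.2 hv'.2
      have h₃ : v * x v ≤ z * x z :=
        mul_le_mul hvz (hmono hv hzmax hvz) (hxrange v hv).1 hz.1
      linarith
  unfold roiPayment
  linarith
end

section
/- Let M > 1, v* > 0, and let x : [0, v*] → ℝ be continuous on [0, v*], differentiable on (0, v*), and satisfy M·(v·x(v) − ∫₀^v x(z) dz) = v·x(v) for all v ∈ (0, v*]. Then x(v) = (v/v*)^{1/(M−1)} · x(v*) for all v ∈ (0, v*]. -/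
open Set MeasureTheory

/-- the first-price ODE. If `x` is continuous on `[0, v*]`,
differentiable on `(0, v*)`, and satisfies `M·(v·x(v) − ∫₀^v x) = v·x(v)` for all
`v ∈ (0, v*]`, then `x(v) = (v/v*)^{1/(M−1)} · x(v*)` on `(0, v*]`. -/
theorem first_price_ode (M vstar : ℝ) (hM : 1 < M) (hvstar : 0 < vstar)
    (x : ℝ → ℝ)
    (hcont : ContinuousOn x (Set.Icc 0 vstar))
    (hdiff : DifferentiableOn ℝ x (Set.Ioo 0 vstar))
    (hint : IntervalIntegrable x MeasureTheory.volume 0 vstar)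
    (heq : ∀ v ∈ Set.Ioc (0:ℝ) vstar,
      M * (v * x v - ∫ z in (0:ℝ)..v, x z) = v * x v) :
    ∀ v ∈ Set.Ioc (0:ℝ) vstar,
      x v = (v / vstar) ^ ((1:ℝ) / (M - 1)) * x vstar := by
  intro v hv
  obtain ⟨hv0, hvs⟩ := hv
  have hM1 : 0 < M - 1 := by linarith
  set a : ℝ := M / (M - 1) with ha
  have ha1 : (1:ℝ) / (M - 1) = a - 1 := by rw [ha]; field_simp; ring
  have hx : ∀ u ∈ Set.Ioc (0:ℝ) vstar, x u = a * (∫ z in (0:ℝ)..u, x z) / u := by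
    intro u hu
    have hu0 : u ≠ 0 := hu.1.ne'
    have h := heq u hu
    rw [ha]
    field_simp
    linarith
  have hFc : ContinuousOn (fun u => ∫ z in (0:ℝ)..u, x z) (Set.Icc 0 vstar) := by
    have h := intervalIntegral.continuousOn_primitive_interval' hint Set.left_mem_uIcc
    rwa [Set.uIcc_of_le hvstar.le] at h
  have hconst := constant_of_has_deriv_right_zero
    (f := fun u => (∫ z in (0:ℝ)..u, x z) * u ^ (-a)) (a := v) (b := vstar)
    ((hFc.mono (Set.Icc_subset_Icc_left hv0.le)).mul
      (continuousOn_id.rpow_const fun u hu => Or.inl (hv0.trans_le hu.1).ne'))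
    (by
      intro u hu
      have hu0 : 0 < u := hv0.trans_le hu.1
      have hmem : u ∈ Set.Ioo 0 vstar := ⟨hu0, hu.2⟩
      have hd : HasDerivAt (fun u => ∫ z in (0:ℝ)..u, x z) (x u) u :=
        intervalIntegral.integral_hasDerivAt_right
          (hint.mono_set (Set.uIcc_subset_uIcc_left
            (by rw [Set.uIcc_of_le hvstar.le]; exact Set.Ioo_subset_Icc_self hmem)))
          (hdiff.continuousOn.stronglyMeasurableAtFilter isOpen_Ioo u hmem)
          (hdiff.continuousOn.continuousAt (isOpen_Ioo.mem_nhds hmem))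
      have hG := hd.mul (Real.hasDerivAt_rpow_const (p := -a) (Or.inl hu0.ne'))
      refine (hG.congr_deriv ?_).hasDerivWithinAt
      rw [hx u ⟨hu0, hu.2.le⟩, Real.rpow_sub_one hu0.ne']
      ring)
    vstar ⟨hvs, le_rfl⟩
  rw [hx v ⟨hv0, hvs⟩, hx vstar ⟨hvstar, le_rfl⟩, ha1, Real.div_rpow hv0.le hvstar.le,
    Real.rpow_sub_one hv0.ne', Real.rpow_sub_one hvstar.ne']
  simp only [Real.rpow_neg hv0.le, Real.rpow_neg hvstar.le] at hconst
  have hva := (Real.rpow_pos_of_pos hv0 a).ne'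
  have hsa := (Real.rpow_pos_of_pos hvstar a).ne'
  clear_value a
  field_simp at hconst ⊢
  linear_combination (-a) * hconst
end

section
/- Suppose the bidder's value distribution on [0, v_max] satisfies the DMR condition. Define the threshold D as follows: if ∫₀^{v_max} ψ(v)·v^{1/(M−1)} dv > 0, let D = D* be the value in (0, v_max) with ∫₀^{D*} ψ(v)·v^{1/(M−1)} dv = 0; otherwise let D = v_max. Define the mechanism (x*, p*) by x*(v) = (v/D)^{1/(M−1)} and p*(v) = v·x*(v) for v < D, and x*(v) = 1 and p*(v) = D for v ≥ D. Then (x*, p*) is DSIC and IR, and its expected revenue is at least the expected revenue of every DSIC and IR mechanism (x, p) with x monotone non-decreasing, x(0) = 0, and right-differentiable with finitely many non-differentiable points; i.e. (x*, p*) is the optimal auction for a single ex post ROI-constrained bidder. -/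
open Set MeasureTheory

/-- A function whose increments are bounded below by a quantity of second order is larger at the
right end of the interval than at the left end. -/
lemma le_of_increment_le {H m : ℝ → ℝ} {α β C : ℝ} (hαβ : α ≤ β)
    (h : ∀ b v, α ≤ b → b ≤ v → v ≤ β → H b - H v ≤ C * (v - b) * (m v - m b)) :
    H α ≤ H β := by
  have key : ∀ n : ℕ, H α - H β ≤ C * (β - α) * (m β - m α) * (1 / ((n : ℝ) + 1)) := by
    intro n
    have hn : (0 : ℝ) < (n : ℝ) + 1 := by positivity
    set δ : ℝ := (β - α) / ((n : ℝ) + 1) with hδ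
    have hδ0 : 0 ≤ δ := div_nonneg (by linarith) hn.le
    have hδn : ((n : ℝ) + 1) * δ = β - α := by rw [hδ]; field_simp
    have ind : ∀ k : ℕ, k ≤ n + 1 →
        H α - H (α + k * δ) ≤ C * δ * (m (α + k * δ) - m α) := by
      intro k
      induction k with
      | zero => intro _; simp
      | succ k ih =>
        intro hk
        have h1 := ih (by omega)
        have hk' : ((k : ℝ) + 1) ≤ (n : ℝ) + 1 := by exact_mod_cast hk
        have hkδ : (0 : ℝ) ≤ k * δ := by positivity
        have h2 := h (α + k * δ) (α + (k + 1 : ℕ) * δ) (by linarith)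
          (by push_cast; linarith) (by
            push_cast
            have := mul_le_mul_of_nonneg_right hk' hδ0
            linarith)
        have h3 : α + ((k + 1 : ℕ) : ℝ) * δ - (α + k * δ) = δ := by push_cast; ring
        rw [h3] at h2
        linarith
    have h1 := ind (n + 1) le_rfl
    have h2 : α + ((n + 1 : ℕ) : ℝ) * δ = β := by push_cast; linarith
    rw [h2] at h1
    refine h1.trans (le_of_eq ?_)
    rw [hδ]; field_simp
  have lim : Filter.Tendsto
      (fun n : ℕ => C * (β - α) * (m β - m α) * (1 / ((n : ℝ) + 1))) Filter.atTop (nhds 0) := by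
    simpa using tendsto_one_div_add_atTop_nhds_zero_nat.const_mul (C * (β - α) * (m β - m α))
  linarith [ge_of_tendsto' lim key]

/-- The average `v⁻ᵠ ∫₀ᵛ zᵠ f(z) dz`. -/
noncomputable def powerMean (q : ℝ) (f : ℝ → ℝ) (v : ℝ) : ℝ :=
  (∫ z in (0:ℝ)..v, z ^ q * f z) / v ^ q

/-- The derivative of `powerMean q f` at positive points. -/
noncomputable def powerMeanDeriv (q : ℝ) (f : ℝ → ℝ) (v : ℝ) : ℝ :=
  f v - q * powerMean q f v / v

section PowerMean

variable {q C : ℝ} {f : ℝ → ℝ}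

lemma continuous_rpow_mul (hq : 1 ≤ q) (hf : Continuous f) :
    Continuous fun z : ℝ => z ^ q * f z :=
  (Real.continuous_rpow_const (by linarith)).mul hf

lemma powerMean_zero : powerMean q f 0 = 0 := by simp [powerMean]

lemma powerMean_nonneg (hf0 : ∀ z, 0 ≤ f z) {v : ℝ} (hv : 0 ≤ v) :
    0 ≤ powerMean q f v := by
  refine div_nonneg (intervalIntegral.integral_nonneg hv fun z hz => ?_) (Real.rpow_nonneg hv q)
  exact mul_nonneg (Real.rpow_nonneg hz.1 q) (hf0 z)

lemma powerMean_le (hq : 1 ≤ q) (hf : Continuous f) (hf0 : ∀ z, 0 ≤ f z) (hfC : ∀ z, f z ≤ C)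
    {v : ℝ} (hv : 0 ≤ v) : powerMean q f v ≤ C * v := by
  rcases hv.eq_or_lt with rfl | hv'
  · simp [powerMean_zero]
  rw [powerMean, div_le_iff₀ (Real.rpow_pos_of_pos hv' q)]
  calc ∫ z in (0:ℝ)..v, z ^ q * f z ≤ ∫ _ in (0:ℝ)..v, v ^ q * C := by
        refine intervalIntegral.integral_mono_on hv
          ((continuous_rpow_mul hq hf).intervalIntegrable _ _) (by simp) fun z hz => ?_
        exact mul_le_mul (Real.rpow_le_rpow hz.1 hz.2 (by linarith)) (hfC z) (hf0 z)
          (Real.rpow_nonneg hv q)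
    _ = C * v * v ^ q := by simp; ring

lemma hasDerivAt_powerMean (hq : 1 ≤ q) (hf : Continuous f) {v : ℝ} (hv : 0 < v) :
    HasDerivAt (powerMean q f) (powerMeanDeriv q f v) v := by
  have hc := continuous_rpow_mul hq hf
  have h1 : HasDerivAt (fun v => ∫ z in (0:ℝ)..v, z ^ q * f z) (v ^ q * f v) v :=
    hc.integral_hasStrictDerivAt 0 v |>.hasDerivAt
  have h2 := Real.hasDerivAt_rpow_const (x := v) (p := q) (Or.inl hv.ne')
  have hvq : v ^ q ≠ 0 := (Real.rpow_pos_of_pos hv q).ne'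
  refine (h1.div h2 hvq).congr_deriv ?_
  rw [powerMeanDeriv, powerMean, Real.rpow_sub_one hv.ne']
  field_simp

lemma continuousOn_powerMean (hq : 1 ≤ q) (hf : Continuous f) (hf0 : ∀ z, 0 ≤ f z)
    (hfC : ∀ z, f z ≤ C) : ContinuousOn (powerMean q f) (Ici 0) := by
  intro v hv
  rcases (show (0:ℝ) ≤ v from hv).eq_or_lt with rfl | hv'
  · rw [ContinuousWithinAt, powerMean_zero]
    have hlim : Filter.Tendsto (fun v : ℝ => C * v) (nhdsWithin 0 (Ici 0)) (nhds 0) := by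
      have : Continuous fun v : ℝ => C * v := by fun_prop
      simpa using (this.tendsto 0).mono_left nhdsWithin_le_nhds
    refine tendsto_of_tendsto_of_tendsto_of_le_of_le' tendsto_const_nhds hlim ?_ ?_
    · filter_upwards [self_mem_nhdsWithin] with z hz using powerMean_nonneg hf0 hz
    · filter_upwards [self_mem_nhdsWithin] with z hz using powerMean_le hq hf hf0 hfC hz
  · exact (hasDerivAt_powerMean hq hf hv').continuousAt.continuousWithinAt

lemma measurable_powerMeanDeriv (hq : 1 ≤ q) (hf : Continuous f) :
    Measurable (powerMeanDeriv q f) := by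
  have h1 : Continuous fun v => ∫ z in (0:ℝ)..v, z ^ q * f z :=
    intervalIntegral.continuous_primitive
      (fun a b => (continuous_rpow_mul hq hf).intervalIntegrable a b) 0
  have h2 : Measurable (powerMean q f) :=
    h1.measurable.div (Real.continuous_rpow_const (by linarith)).measurable
  exact hf.measurable.sub ((h2.const_mul q).div measurable_id)

lemma abs_powerMeanDeriv_le (hq : 1 ≤ q) (hf : Continuous f) (hf0 : ∀ z, 0 ≤ f z)
    (hfC : ∀ z, f z ≤ C) {v : ℝ} (hv : 0 ≤ v) : |powerMeanDeriv q f v| ≤ (1 + q) * C := by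
  have hC : 0 ≤ C := (hf0 0).trans (hfC 0)
  have h1 : 0 ≤ q * powerMean q f v / v :=
    div_nonneg (mul_nonneg (by linarith) (powerMean_nonneg hf0 hv)) hv
  have h2 : q * powerMean q f v / v ≤ q * C := by
    refine div_le_of_le_mul₀ hv (by positivity) ?_
    nlinarith [powerMean_le hq hf hf0 hfC hv]
  rw [powerMeanDeriv, abs_le]
  constructor <;> nlinarith [hf0 v, hfC v]

lemma intervalIntegrable_powerMeanDeriv (hq : 1 ≤ q) (hf : Continuous f) (hf0 : ∀ z, 0 ≤ f z)
    (hfC : ∀ z, f z ≤ C) {b v : ℝ} (hb : 0 ≤ b) (hbv : b ≤ v) :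
    IntervalIntegrable (powerMeanDeriv q f) volume b v := by
  rw [intervalIntegrable_iff_integrableOn_Ioc_of_le hbv]
  refine Measure.integrableOn_of_bounded (M := (1 + q) * C) (by simp)
    (measurable_powerMeanDeriv hq hf).aestronglyMeasurable ?_
  filter_upwards [ae_restrict_mem measurableSet_Ioc] with z hz
  exact abs_powerMeanDeriv_le hq hf hf0 hfC (hb.trans hz.1.le)

lemma integral_powerMeanDeriv (hq : 1 ≤ q) (hf : Continuous f) (hf0 : ∀ z, 0 ≤ f z)
    (hfC : ∀ z, f z ≤ C) {b v : ℝ} (hb : 0 ≤ b) (hbv : b ≤ v) :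
    ∫ z in b..v, powerMeanDeriv q f z = powerMean q f v - powerMean q f b :=
  intervalIntegral.integral_eq_sub_of_hasDerivAt_of_le hbv
    ((continuousOn_powerMean hq hf hf0 hfC).mono fun _ hz => hb.trans hz.1)
    (fun _ hz => hasDerivAt_powerMean hq hf (hb.trans_lt hz.1))
    (intervalIntegrable_powerMeanDeriv hq hf hf0 hfC hb hbv)

lemma powerMean_sub_le (hq : 1 ≤ q) (hf : Continuous f) (hf0 : ∀ z, 0 ≤ f z)
    (hfC : ∀ z, f z ≤ C) {b v : ℝ} (hb : 0 ≤ b) (hbv : b ≤ v) :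
    powerMean q f v - powerMean q f b ≤ (1 + q) * C * (v - b) := by
  rw [← integral_powerMeanDeriv hq hf hf0 hfC hb hbv]
  calc ∫ z in b..v, powerMeanDeriv q f z ≤ ∫ _ in b..v, (1 + q) * C :=
        intervalIntegral.integral_mono_on hbv
          (intervalIntegrable_powerMeanDeriv hq hf hf0 hfC hb hbv) (by simp) fun z hz =>
          (le_abs_self _).trans (abs_powerMeanDeriv_le hq hf hf0 hfC (hb.trans hz.1))
    _ = (1 + q) * C * (v - b) := by simp; ring

end PowerMean

section Revenue

variable {q a M C D V : ℝ} {f x U : ℝ → ℝ}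

/-- Integrated form of the interplay between `powerMean` and utility increments below the
threshold `D`. -/
lemma integral_powerMean_mul_add_le (hq : 1 ≤ q) (ha : 0 ≤ a) (haM : a * M = q)
    (hf : Continuous f) (hf0 : ∀ z, 0 ≤ f z) (hfC : ∀ z, f z ≤ C) (hD : 0 ≤ D)
    (hx : MonotoneOn x (Icc 0 D)) (hx01 : ∀ v ∈ Icc 0 D, x v ∈ Icc (0:ℝ) 1)
    (hUm : MonotoneOn U (Icc 0 D))
    (hU : ∀ b v, 0 ≤ b → b ≤ v → v ≤ D → M * (v - b) * x b ≤ U v - U b) :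
    ∫ z in (0:ℝ)..D, (q * powerMean q f z * x z + a * U z * powerMeanDeriv q f z) ≤
      a * U D * powerMean q f D := by
  have hC : 0 ≤ C := (hf0 0).trans (hfC 0)
  have hxi : ∀ b v, 0 ≤ b → b ≤ v → v ≤ D → IntervalIntegrable x volume b v :=
    fun b v hb hbv hv =>
      (hx.mono (by rw [uIcc_of_le hbv]; exact Icc_subset_Icc hb hv)).intervalIntegrable
  set R := powerMean q f with hR
  set r := powerMeanDeriv q f with hr
  have hRc : ContinuousOn R (Ici 0) := continuousOn_powerMean hq hf hf0 hfC
  have hi1 : ∀ b v, 0 ≤ b → b ≤ v → v ≤ D →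
      IntervalIntegrable (fun z => q * R z * x z) volume b v := fun b v hb hbv hv =>
    (hxi b v hb hbv hv).continuousOn_mul ((hRc.mono (by
      rw [uIcc_of_le hbv]; exact fun z hz => hb.trans hz.1)).const_mul q)
  have hri : ∀ b v, 0 ≤ b → b ≤ v → IntervalIntegrable r volume b v :=
    fun b v hb hbv => intervalIntegrable_powerMeanDeriv hq hf hf0 hfC hb hbv
  have hi2 : ∀ b v, 0 ≤ b → b ≤ v → v ≤ D →
      IntervalIntegrable (fun z => a * U z * r z) volume b v := by
    intro b v hb hbv hv
    have hUi : IntervalIntegrable U volume b v :=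
      (hUm.mono (by rw [uIcc_of_le hbv]; exact Icc_subset_Icc hb hv)).intervalIntegrable
    rw [intervalIntegrable_iff_integrableOn_Ioc_of_le hbv] at hUi ⊢
    refine (hUi.const_mul a).mul_bdd (c := (1 + q) * C)
      (measurable_powerMeanDeriv hq hf).aestronglyMeasurable ?_
    filter_upwards [ae_restrict_mem measurableSet_Ioc] with z hz
    exact abs_powerMeanDeriv_le hq hf hf0 hfC (hb.trans hz.1.le)
  have hi : ∀ b v, 0 ≤ b → b ≤ v → v ≤ D →
      IntervalIntegrable (fun z => q * R z * x z + a * U z * r z) volume b v :=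
    fun b v hb hbv hv => (hi1 b v hb hbv hv).add (hi2 b v hb hbv hv)
  set J : ℝ → ℝ := fun v =>
    a * U v * R v - ∫ z in (0:ℝ)..v, (q * R z * x z + a * U z * r z) with hJ
  set K : ℝ := a * ((1 + q) * C) + q * ((1 + q) * C) + q * (C * D) with hK
  have hL : 0 ≤ (1 + q) * C := by positivity
  have key : J 0 ≤ J D := by
    refine le_of_increment_le (m := fun v => v + x v + U v) (C := K) hD ?_
    intro b v hb hbv hv
    have hbm : b ∈ Icc 0 D := ⟨hb, hbv.trans hv⟩
    have hvm : v ∈ Icc 0 D := ⟨hb.trans hbv, hv⟩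
    have hadd : (∫ z in (0:ℝ)..v, (q * R z * x z + a * U z * r z)) =
        (∫ z in (0:ℝ)..b, (q * R z * x z + a * U z * r z)) +
        ∫ z in b..v, (q * R z * x z + a * U z * r z) :=
      (intervalIntegral.integral_add_adjacent_intervals (hi 0 b le_rfl hb (hbv.trans hv))
        (hi b v hb hbv hv)).symm
    have hRint : ∫ z in b..v, r z = R v - R b := integral_powerMeanDeriv hq hf hf0 hfC hb hbv
    have hx' : x b ≤ x v := hx hbm hvm hbv
    have hU' : U b ≤ U v := hUm hbm hvm hbv
    have hRb : 0 ≤ R b := powerMean_nonneg hf0 hb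
    have hbound : (∫ z in b..v, (q * R z * x z + a * U z * r z)) - a * U v * (R v - R b) ≤
        (v - b) * (q * (R b * x b) + (a * ((1 + q) * C) * (U v - U b) +
          q * ((1 + q) * C * (v - b) + C * D * (x v - x b)))) := by
      rw [← hRint, ← intervalIntegral.integral_const_mul,
        ← intervalIntegral.integral_sub (hi b v hb hbv hv) ((hri b v hb hbv).const_mul _)]
      calc _ ≤ ∫ _ in b..v, (q * (R b * x b) + (a * ((1 + q) * C) * (U v - U b) +
          q * ((1 + q) * C * (v - b) + C * D * (x v - x b)))) := by
            refine intervalIntegral.integral_mono_on hbv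
              ((hi b v hb hbv hv).sub ((hri b v hb hbv).const_mul _)) (by simp) fun z hz => ?_
            have hz0 : 0 ≤ z := hb.trans hz.1
            have hzm : z ∈ Icc 0 D := ⟨hz0, hz.2.trans hv⟩
            have hUz : U z ≤ U v := hUm hzm hvm hz.2
            have hUb : U b ≤ U z := hUm hbm hzm hz.1
            have hxz : x z ≤ x v := hx hzm hvm hz.2
            have hxb : x b ≤ x z := hx hbm hzm hz.1
            have h1 : -r z ≤ (1 + q) * C :=
              (neg_le_abs _).trans (abs_powerMeanDeriv_le hq hf hf0 hfC hz0)
            have h2 : R z - R b ≤ (1 + q) * C * (z - b) :=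
              powerMean_sub_le hq hf hf0 hfC hb hz.1
            have h3 : R b ≤ C * D := (powerMean_le hq hf hf0 hfC hb).trans
              (mul_le_mul_of_nonneg_left (hbv.trans hv) hC)
            have h4 : (U v - U z) * -r z ≤ (1 + q) * C * (U v - U b) := by
              calc (U v - U z) * -r z ≤ (U v - U z) * ((1 + q) * C) :=
                    mul_le_mul_of_nonneg_left h1 (by linarith)
                _ ≤ (1 + q) * C * (U v - U b) := by
                    rw [mul_comm]; exact mul_le_mul_of_nonneg_left (by linarith) hL
            have h5 : (R z - R b) * x z ≤ (1 + q) * C * (v - b) := by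
              have h6 : (R z - R b) * x z ≤ (1 + q) * C * (z - b) * x z :=
                mul_le_mul_of_nonneg_right h2 (hx01 z hzm).1
              have h7 : (1 + q) * C * (z - b) * x z ≤ (1 + q) * C * (z - b) * 1 :=
                mul_le_mul_of_nonneg_left (hx01 z hzm).2
                  (mul_nonneg hL (by linarith [hz.1]))
              have h8 : (1 + q) * C * (z - b) ≤ (1 + q) * C * (v - b) :=
                mul_le_mul_of_nonneg_left (by linarith [hz.2]) hL
              linarith
            have h6 : R b * (x z - x b) ≤ C * D * (x v - x b) :=
              mul_le_mul h3 (by linarith) (by linarith) (by positivity)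
            have h7 := mul_le_mul_of_nonneg_left h4 ha
            have h8 := mul_le_mul_of_nonneg_left (add_le_add h5 h6) (by linarith : 0 ≤ q)
            linarith
        _ = _ := by rw [intervalIntegral.integral_const, smul_eq_mul]
    have hinc : q * (v - b) * x b * R b ≤ a * (U v - U b) * R b := by
      refine mul_le_mul_of_nonneg_right ?_ hRb
      have := mul_le_mul_of_nonneg_left (hU b v hb hbv hv) ha
      rw [← haM]; linarith
    have hvb : 0 ≤ v - b := by linarith
    have e1 : 0 ≤ (v - b) * ((v - b) * (a * ((1 + q) * C) + q * (C * D)) +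
        (x v - x b) * (a * ((1 + q) * C) + q * ((1 + q) * C)) +
        (U v - U b) * (q * ((1 + q) * C) + q * (C * D))) := by
      have : 0 ≤ x v - x b := by linarith
      have : 0 ≤ U v - U b := by linarith
      positivity
    simp only [hJ, hadd, hK]
    linarith
  simp only [hJ, hR, powerMean_zero, intervalIntegral.integral_same] at key
  linarith

/-- Revenue bound above the threshold `D`. -/
lemma integral_revenue_above_le (hM : 0 ≤ M) (hf : Continuous f) (hf0 : ∀ z, 0 ≤ f z)
    (hD : 0 ≤ D) (hDV : D ≤ V) (hFV : ∫ z in (0:ℝ)..V, f z = 1)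
    (hψ : ∀ v ∈ Icc D V, 0 ≤ v * f v + (∫ z in (0:ℝ)..v, f z) - 1)
    (hx : MonotoneOn x (Icc D V)) (hx01 : ∀ v ∈ Icc D V, x v ∈ Icc (0:ℝ) 1)
    (hUm : MonotoneOn U (Icc D V))
    (hU : ∀ b v, D ≤ b → b ≤ v → v ≤ V → M * (v - b) * x b ≤ U v - U b) :
    U D * (1 - ∫ z in (0:ℝ)..D, f z) + ∫ z in D..V, (M * z * x z - U z) * f z ≤
      M * D * (1 - ∫ z in (0:ℝ)..D, f z) := by
  set F : ℝ → ℝ := fun v => ∫ z in (0:ℝ)..v, f z with hF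
  have hFd : ∀ v, HasDerivAt F (f v) v := fun v =>
    (hf.integral_hasStrictDerivAt 0 v).hasDerivAt
  have hFc : Continuous F := continuous_iff_continuousAt.2 fun v => (hFd v).continuousAt
  have hFi : ∀ b v, ∫ z in b..v, f z = F v - F b := fun b v =>
    (intervalIntegral.integral_interval_sub_left (hf.intervalIntegrable _ _)
      (hf.intervalIntegrable _ _)).symm
  have hFm : Monotone F := fun b v hbv => by
    have : 0 ≤ ∫ z in b..v, f z := intervalIntegral.integral_nonneg hbv fun z _ => hf0 z
    rw [hFi] at this; linarith
  have hFV' : F V = 1 := hFV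
  have hF0 : F 0 = 0 := by simp [hF]
  have hψi : ∀ b v, ∫ z in b..v, (z * f z + F z - 1) = v * (F v - 1) - b * (F b - 1) := by
    intro b v
    refine intervalIntegral.integral_eq_sub_of_hasDerivAt (f := fun z => z * (F z - 1))
      (fun z _ => ?_) (Continuous.intervalIntegrable (by fun_prop) _ _)
    exact ((hasDerivAt_id z).mul ((hFd z).sub_const 1)).congr_deriv (by simp; ring)
  have hi : ∀ b v, D ≤ b → b ≤ v → v ≤ V →
      IntervalIntegrable (fun z => (M * z * x z - U z) * f z) volume b v := by
    intro b v hb hbv hv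
    have hs : uIcc b v ⊆ Icc D V := by rw [uIcc_of_le hbv]; exact Icc_subset_Icc hb hv
    have h1 := (hx.mono hs).intervalIntegrable (μ := volume)
    have h2 := (hUm.mono hs).intervalIntegrable (μ := volume)
    exact ((h1.continuousOn_mul (Continuous.continuousOn (by fun_prop))).sub h2).mul_continuousOn
      hf.continuousOn
  set J : ℝ → ℝ := fun v => U v * (1 - F v) -
    (∫ z in D..v, (M * z * x z - U z) * f z) + M * (v * (F v - 1)) with hJ
  have key : J D ≤ J V := by
    refine le_of_increment_le (m := fun v => x v + F v) (C := M) hDV ?_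
    intro b v hb hbv hv
    have hbm : b ∈ Icc D V := ⟨hb, hbv.trans hv⟩
    have hvm : v ∈ Icc D V := ⟨hb.trans hbv, hv⟩
    have hadd : (∫ z in D..v, (M * z * x z - U z) * f z) =
        (∫ z in D..b, (M * z * x z - U z) * f z) +
        ∫ z in b..v, (M * z * x z - U z) * f z :=
      (intervalIntegral.integral_add_adjacent_intervals (hi D b le_rfl hb (hbv.trans hv))
        (hi b v hb hbv hv)).symm
    have hx' : x b ≤ x v := hx hbm hvm hbv
    have hF' : F b ≤ F v := hFm hbv
    have hFle : ∀ z ≤ V, F z ≤ 1 := fun z hz => by rw [← hFV']; exact hFm hz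
    have hFb0 : 0 ≤ F b := by rw [← hF0]; exact hFm (hD.trans hb)
    have hbound : (∫ z in b..v, (M * z * x z - U z) * f z) -
        M * (v * (F v - 1) - b * (F b - 1)) + U b * (F v - F b) ≤
        (v - b) * (M * (x v * (1 - F b))) := by
      have hψI : IntervalIntegrable (fun z => M * (z * f z + F z - 1)) volume b v :=
        Continuous.intervalIntegrable (by fun_prop) _ _
      have hfI : IntervalIntegrable (fun z => U b * f z) volume b v :=
        Continuous.intervalIntegrable (by fun_prop) _ _
      rw [← hψi, ← hFi, ← intervalIntegral.integral_const_mul,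
        ← intervalIntegral.integral_const_mul,
        ← intervalIntegral.integral_sub (hi b v hb hbv hv) hψI,
        ← intervalIntegral.integral_add ((hi b v hb hbv hv).sub hψI) hfI]
      calc _ ≤ ∫ _ in b..v, M * (x v * (1 - F b)) := by
            refine intervalIntegral.integral_mono_on hbv
              (((hi b v hb hbv hv).sub hψI).add hfI) (by simp) fun z hz => ?_
            have hzm : z ∈ Icc D V := ⟨hb.trans hz.1, hz.2.trans hv⟩
            have h1 : 0 ≤ (U z - U b) * f z :=
              mul_nonneg (sub_nonneg.2 (hUm hbm hzm hz.1)) (hf0 z)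
            have h2 : x z * (1 - F z) ≤ x v * (1 - F b) :=
              mul_le_mul (hx hzm hvm hz.2) (by linarith [hFm hz.1])
                (by linarith [hFle z hzm.2]) (hx01 v hvm).1
            have h3 : 0 ≤ (1 - x z) * (z * f z + F z - 1) :=
              mul_nonneg (by linarith [(hx01 z hzm).2]) (hψ z hzm)
            have h4 := mul_le_mul_of_nonneg_left h2 hM
            have h5 := mul_nonneg hM h3
            linarith
        _ = _ := by rw [intervalIntegral.integral_const, smul_eq_mul]
    have h1F : 0 ≤ 1 - F v := by linarith [hFle v hv]
    have hinc := mul_le_mul_of_nonneg_right (hU b v hb hbv hv) h1F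
    have h6 : x v * (1 - F b) - x b * (1 - F v) ≤ (x v - x b) + (F v - F b) := by
      have e1 : 0 ≤ (x v - x b) * F b := mul_nonneg (by linarith) hFb0
      have e2 : 0 ≤ (1 - x b) * (F v - F b) :=
        mul_nonneg (by linarith [(hx01 b hbm).2]) (by linarith)
      linarith
    have h7 := mul_le_mul_of_nonneg_left h6 (mul_nonneg hM (by linarith : 0 ≤ v - b))
    simp only [hJ, hadd]
    linarith
  simp only [hJ, hFV', intervalIntegral.integral_same] at key
  linarith

lemma integral_virtualValue_mul_rpow (ha : 0 < a) (hqa : q = a + 1) (hf : Continuous f) {v : ℝ}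
    (hv : 0 ≤ v) :
    q * ∫ z in (0:ℝ)..v, (z * f z + (∫ t in (0:ℝ)..z, f t) - 1) * z ^ a =
      v ^ q * ((∫ t in (0:ℝ)..v, f t) - 1) + a * ∫ z in (0:ℝ)..v, z ^ q * f z := by
  have hFd : ∀ v, HasDerivAt (fun v => ∫ t in (0:ℝ)..v, f t) (f v) v := fun v =>
    (hf.integral_hasStrictDerivAt 0 v).hasDerivAt
  have hFc : Continuous fun v => ∫ t in (0:ℝ)..v, f t :=
    continuous_iff_continuousAt.2 fun v => (hFd v).continuousAt
  have hpa : Continuous fun z : ℝ => z ^ a := Real.continuous_rpow_const ha.le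
  have hpq : Continuous fun z : ℝ => z ^ q := Real.continuous_rpow_const (by linarith)
  have hd : ∀ z, HasDerivAt (fun z : ℝ => z ^ q * ((∫ t in (0:ℝ)..z, f t) - 1))
      (q * z ^ a * ((∫ t in (0:ℝ)..z, f t) - 1) + z ^ q * f z) z := fun z => by
    have := Real.hasDerivAt_rpow_const (x := z) (p := q) (Or.inr (by linarith))
    rw [show q - 1 = a by linarith] at this
    exact this.mul ((hFd z).sub_const 1)
  have h1 := intervalIntegral.integral_eq_sub_of_hasDerivAt (a := 0) (b := v) (fun z _ => hd z)
    (Continuous.intervalIntegrable (by fun_prop) _ _)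
  rw [Real.zero_rpow (by linarith : q ≠ 0), zero_mul, sub_zero] at h1
  rw [← h1, ← intervalIntegral.integral_const_mul, ← intervalIntegral.integral_const_mul,
    ← intervalIntegral.integral_add (Continuous.intervalIntegrable (by fun_prop) _ _)
      (Continuous.intervalIntegrable (by fun_prop) _ _)]
  refine intervalIntegral.integral_congr fun z hz => ?_
  rw [uIcc_of_le hv] at hz
  have hzq : z ^ q = z ^ a * z := by
    rw [hqa, Real.rpow_add_one' hz.1 (by linarith)]
  rw [hzq, hqa]
  ring

lemma integral_monotoneOn_mul_rpow_le {ψ : ℝ → ℝ} (ha : 0 < a) (hqa : q = a + 1) {v : ℝ}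
    (hv : 0 ≤ v) (hψ : MonotoneOn ψ (Icc 0 v)) :
    q * ∫ z in (0:ℝ)..v, ψ z * z ^ a ≤ ψ v * v ^ q := by
  have hpa : Continuous fun z : ℝ => z ^ a := Real.continuous_rpow_const ha.le
  have h1 : ∫ z in (0:ℝ)..v, ψ z * z ^ a ≤ ∫ z in (0:ℝ)..v, ψ v * z ^ a := by
    refine intervalIntegral.integral_mono_on hv ?_
      ((continuous_const.mul hpa).intervalIntegrable _ _) fun z hz => ?_
    · exact IntervalIntegrable.mul_continuousOn
        (MonotoneOn.intervalIntegrable (by rwa [uIcc_of_le hv])) hpa.continuousOn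
    · exact mul_le_mul_of_nonneg_right (hψ hz ⟨hv, le_rfl⟩ hz.2) (Real.rpow_nonneg hz.1 a)
  rw [intervalIntegral.integral_const_mul, integral_rpow (Or.inl (by linarith)), ← hqa,
    Real.zero_rpow (by linarith), sub_zero] at h1
  have hq : 0 < q := by linarith
  calc _ ≤ q * (ψ v * (v ^ q / q)) := mul_le_mul_of_nonneg_left h1 hq.le
    _ = _ := by field_simp

/-- Every incentive compatible, individually rational payment rule has revenue at most
`M·D·(1 − F(D))`. -/
lemma integral_payment_le (ha : 0 < a) (hqa : q = a + 1) (haM : a * M = q)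
    (hf : Continuous f) (hf0 : ∀ z, 0 ≤ f z) (hfC : ∀ z, f z ≤ C)
    (hD : 0 < D) (hDV : D ≤ V) (hFV : ∫ z in (0:ℝ)..V, f z = 1)
    (hDMR : MonotoneOn (fun v => v * f v + (∫ t in (0:ℝ)..v, f t) - 1) (Icc 0 V))
    (hK : ∫ z in (0:ℝ)..D, (z * f z + (∫ t in (0:ℝ)..z, f t) - 1) * z ^ a = 0)
    (hx : MonotoneOn x (Icc 0 V)) (hx01 : ∀ v ∈ Icc 0 V, x v ∈ Icc (0:ℝ) 1) {p : ℝ → ℝ}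
    (hp : ∀ v ∈ Icc 0 V, p v ≤ v * x v)
    (hIC : ∀ b v, 0 ≤ b → b ≤ v → v ≤ V → M * v * x b - p b ≤ M * v * x v - p v) :
    ∫ v in (0:ℝ)..V, p v * f v ≤ M * D * (1 - ∫ z in (0:ℝ)..D, f z) := by
  have hM : 0 ≤ M := by nlinarith
  have hq : 1 ≤ q := by linarith
  set F : ℝ → ℝ := fun v => ∫ z in (0:ℝ)..v, f z with hF
  set U : ℝ → ℝ := fun v => M * v * x v - p v with hUdef
  have hU : ∀ b v, 0 ≤ b → b ≤ v → v ≤ V → M * (v - b) * x b ≤ U v - U b := by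
    intro b v hb hbv hv
    have := hIC b v hb hbv hv
    simp only [hUdef]
    linarith
  have hUm : MonotoneOn U (Icc 0 V) := fun b hb v hv hbv => by
    have h1 := hU b v hb.1 hbv hv.2
    have h2 : 0 ≤ M * (v - b) * x b :=
      mul_nonneg (mul_nonneg hM (by linarith)) (hx01 b hb).1
    linarith
  have hψR : ∀ v ∈ Icc 0 V, 0 < v → a * powerMean q f v ≤ v * f v := by
    intro v hv hv0
    have h1 := integral_monotoneOn_mul_rpow_le ha hqa hv.1
      (hDMR.mono (Icc_subset_Icc_right hv.2))
    rw [integral_virtualValue_mul_rpow ha hqa hf hv.1] at h1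
    have hvq := Real.rpow_pos_of_pos hv0 q
    rw [powerMean, ← mul_div_assoc, div_le_iff₀ hvq]
    linarith
  have hRD : a * powerMean q f D = 1 - F D := by
    have h1 := integral_virtualValue_mul_rpow ha hqa hf hD.le
    rw [hK] at h1
    have hDq := Real.rpow_pos_of_pos hD q
    rw [powerMean, ← mul_div_assoc, div_eq_iff hDq.ne']
    simp only [hF]
    linarith
  have hψD : 0 ≤ D * f D + F D - 1 := by
    have h1 := hψR D ⟨hD.le, hDV⟩ hD
    linarith
  have hlow := integral_powerMean_mul_add_le (D := D) hq ha.le haM hf hf0 hfC hD.le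
    (hx.mono (Icc_subset_Icc_right hDV)) (fun v hv => hx01 v ⟨hv.1, hv.2.trans hDV⟩)
    (hUm.mono (Icc_subset_Icc_right hDV)) (fun b v hb hbv hv => hU b v hb hbv (hv.trans hDV))
  have hhigh := integral_revenue_above_le (x := x) (U := U) hM hf hf0 hD.le hDV hFV
    (fun v hv => hψD.trans (hDMR ⟨hD.le, hDV⟩ ⟨hD.le.trans hv.1, hv.2⟩ hv.1))
    (hx.mono (Icc_subset_Icc_left hD.le)) (fun v hv => hx01 v ⟨hD.le.trans hv.1, hv.2⟩)
    (hUm.mono (Icc_subset_Icc_left hD.le)) (fun b v hb hbv hv => hU b v (hD.le.trans hb) hbv hv)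
  have hpU : ∀ v, p v = M * v * x v - U v := fun v => by simp only [hUdef]; ring
  have hi : ∀ b v, 0 ≤ b → b ≤ v → v ≤ V →
      IntervalIntegrable (fun z => (M * z * x z - U z) * f z) volume b v := by
    intro b v hb hbv hv
    have hs : uIcc b v ⊆ Icc 0 V := by rw [uIcc_of_le hbv]; exact Icc_subset_Icc hb hv
    have h1 := (hx.mono hs).intervalIntegrable (μ := volume)
    have h2 := (hUm.mono hs).intervalIntegrable (μ := volume)
    exact ((h1.continuousOn_mul (Continuous.continuousOn (by fun_prop))).sub h2).mul_continuousOn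
      hf.continuousOn
  have hmid : ∫ z in (0:ℝ)..D, (M * z * x z - U z) * f z ≤
      ∫ z in (0:ℝ)..D, (q * powerMean q f z * x z + a * U z * powerMeanDeriv q f z) := by
    have hs : uIcc 0 D ⊆ Icc 0 V := by
      rw [uIcc_of_le hD.le]; exact Icc_subset_Icc_right hDV
    refine intervalIntegral.integral_mono_on_of_le_Ioo hD.le (hi 0 D le_rfl hD.le hDV) ?_
      fun z hz => ?_
    · refine IntervalIntegrable.add ?_ ?_
      · exact (hx.mono hs).intervalIntegrable.continuousOn_mul
          (((continuousOn_powerMean hq hf hf0 hfC).mono (by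
            rw [uIcc_of_le hD.le]; exact fun z hz => hz.1)).const_mul q)
      · have hUi := (hUm.mono hs).intervalIntegrable (μ := volume)
        rw [intervalIntegrable_iff_integrableOn_Ioc_of_le hD.le] at hUi ⊢
        refine (hUi.const_mul a).mul_bdd (c := (1 + q) * C)
          (measurable_powerMeanDeriv hq hf).aestronglyMeasurable ?_
        filter_upwards [ae_restrict_mem measurableSet_Ioc] with z hz
        exact abs_powerMeanDeriv_le hq hf hf0 hfC hz.1.le
    · have hzm : z ∈ Icc 0 V := ⟨hz.1.le, hz.2.le.trans hDV⟩
      have h1 : 0 ≤ f z + a * powerMeanDeriv q f z := by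
        have h2 : f z + a * powerMeanDeriv q f z = q * (z * f z - a * powerMean q f z) / z := by
          rw [powerMeanDeriv, eq_div_iff hz.1.ne', hqa]
          have := hz.1.ne'
          field_simp
          ring
        rw [h2]
        exact div_nonneg (mul_nonneg (by linarith) (by linarith [hψR z hzm hz.1])) hz.1.le
      have h3 : 0 ≤ U z - (M - 1) * z * x z := by
        have := hp z hzm
        simp only [hUdef]
        linarith
      have h4 := mul_nonneg h1 h3
      have h5 : z * powerMeanDeriv q f z = z * f z - q * powerMean q f z := by
        rw [powerMeanDeriv]
        have := hz.1.ne'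
        field_simp
      have h6 : a * (M - 1) = 1 := by linarith
      have h7 : (f z + a * powerMeanDeriv q f z) * (U z - (M - 1) * z * x z) =
          f z * U z - (M - 1) * z * x z * f z + a * U z * powerMeanDeriv q f z -
            (a * (M - 1)) * x z * (z * powerMeanDeriv q f z) := by ring
      rw [h7, h6, h5] at h4
      linarith
  have hsplit := intervalIntegral.integral_add_adjacent_intervals (hi 0 D le_rfl hD.le hDV)
    (hi D V hD.le hDV le_rfl)
  simp only [hpU]
  have : a * U D * powerMean q f D = U D * (1 - F D) := by rw [← hRD]; ring
  linarith

lemma integral_optimal_payment (ha : 0 < a) (hqa : q = a + 1) (haM : a * M = q)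
    (hf : Continuous f) (hD : 0 < D) (hDV : D ≤ V) (hFV : ∫ z in (0:ℝ)..V, f z = 1)
    (hK : ∫ z in (0:ℝ)..D, (z * f z + (∫ t in (0:ℝ)..z, f t) - 1) * z ^ a = 0) {p : ℝ → ℝ}
    (hplt : ∀ v < D, p v = v * (v / D) ^ a) (hpge : ∀ v, D ≤ v → p v = D) :
    ∫ v in (0:ℝ)..V, p v * f v = M * D * (1 - ∫ z in (0:ℝ)..D, f z) := by
  have hDq : D ^ q = D ^ a * D := by rw [hqa, Real.rpow_add_one hD.ne']
  have hDa := (Real.rpow_pos_of_pos hD a).ne'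
  have hpa : Continuous fun z : ℝ => z ^ q := Real.continuous_rpow_const (by linarith)
  have h1 : EqOn (fun v => p v * f v) (fun v => (D ^ a)⁻¹ * (v ^ q * f v)) (uIcc 0 D) := by
    intro v hv
    rw [uIcc_of_le hD.le] at hv
    have hpv : p v = v * (v / D) ^ a := by
      rcases hv.2.lt_or_eq with h | rfl
      · exact hplt v h
      · rw [hpge v le_rfl, div_self hD.ne', Real.one_rpow, mul_one]
    simp only
    rw [hpv, Real.div_rpow hv.1 hD.le, hqa, Real.rpow_add_one' hv.1 (by linarith)]
    field_simp
  have h2 : EqOn (fun v => p v * f v) (fun v => D * f v) (uIcc D V) := by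
    intro v hv
    rw [uIcc_of_le hDV] at hv
    simp only [hpge v hv.1]
  have i1 : IntervalIntegrable (fun v => p v * f v) volume 0 D :=
    IntervalIntegrable.congr (f := fun v => (D ^ a)⁻¹ * (v ^ q * f v))
      (fun v hv => (h1 (uIoc_subset_uIcc hv)).symm)
      (Continuous.intervalIntegrable (by fun_prop) _ _)
  have i2 : IntervalIntegrable (fun v => p v * f v) volume D V :=
    IntervalIntegrable.congr (f := fun v => D * f v)
      (fun v hv => (h2 (uIoc_subset_uIcc hv)).symm)
      (Continuous.intervalIntegrable (by fun_prop) _ _)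
  have h3 := integral_virtualValue_mul_rpow ha hqa hf hD.le
  rw [hK] at h3
  have h4 := intervalIntegral.integral_interval_sub_left (hf.intervalIntegrable (μ := volume) 0 V)
    (hf.intervalIntegrable 0 D)
  rw [← intervalIntegral.integral_add_adjacent_intervals i1 i2,
    intervalIntegral.integral_congr h1, intervalIntegral.integral_congr h2,
    intervalIntegral.integral_const_mul, intervalIntegral.integral_const_mul, ← h4, hFV]
  have h5 : ∫ z in (0:ℝ)..D, z ^ q * f z =
      (M - 1) * (D ^ a * D) * (1 - ∫ t in (0:ℝ)..D, f t) := by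
    have h6 : (M - 1) * a = 1 := by linarith
    rw [hDq] at h3
    have h7 : ∫ z in (0:ℝ)..D, z ^ q * f z =
        (M - 1) * (a * ∫ z in (0:ℝ)..D, z ^ q * f z) := by rw [← mul_assoc, h6, one_mul]
    rw [h7]
    linear_combination (-(M - 1)) * h3
  rw [h5]
  field_simp
  ring

end Revenue

section Mechanism

variable {a M D V : ℝ} {x p : ℝ → ℝ}

lemma monotoneOn_sub_mul_rpow (ha : 0 < a) (haM : a * M = a + 1) (v : ℝ) :
    MonotoneOn (fun b : ℝ => (M * v - b) * b ^ a) (Icc 0 v) := by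
  refine monotoneOn_of_hasDerivWithinAt_nonneg (convex_Icc 0 v)
    (f' := fun b => -b ^ a + (M * v - b) * (a * b ^ (a - 1)))
    (Continuous.continuousOn (Continuous.mul (by fun_prop) (Real.continuous_rpow_const ha.le)))
    (fun b hb => ?_) fun b hb => ?_
  · rw [interior_Icc] at hb
    have h1 := Real.hasDerivAt_rpow_const (x := b) (p := a) (Or.inl hb.1.ne')
    exact ((((hasDerivAt_id b).const_sub (M * v)).mul h1).congr_deriv (by simp)).hasDerivWithinAt
  · rw [interior_Icc] at hb
    have h1 := Real.rpow_pos_of_pos hb.1 a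
    rw [Real.rpow_sub_one hb.1.ne']
    have h2 : -b ^ a + (M * v - b) * (a * (b ^ a / b)) = (a * M * v - (a + 1) * b) * b ^ a / b := by
      have := hb.1.ne'
      field_simp
      ring
    rw [h2, haM, ← mul_sub]
    exact div_nonneg (mul_nonneg (mul_nonneg (by linarith) (by linarith [hb.2])) h1.le) hb.1.le

lemma payment_le_of_IR (h : IR M V x p) {v : ℝ} (hv : v ∈ Icc 0 V) : p v ≤ v * x v := by
  by_contra hn
  have := h v hv
  simp [utility, hn] at this

lemma utility_le_of_DSIC (h : DSIC M V x p) (hIR : IR M V x p) {b v : ℝ} (hb : b ∈ Icc 0 V)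
    (hv : v ∈ Icc 0 V) (hbv : b ≤ v) (hx : 0 ≤ x b) :
    M * v * x b - p b ≤ M * v * x v - p v := by
  have h1 := h v hv b hb
  have h2 : p b ≤ v * x b :=
    (payment_le_of_IR hIR hb).trans (mul_le_mul_of_nonneg_right hbv hx)
  rw [utility, utility, if_pos h2, if_pos (payment_le_of_IR hIR hv)] at h1
  exact_mod_cast h1

lemma thresholdMechanism_payment_le
    (hx : ∀ v, x v = if v < D then (v / D) ^ a else 1)
    (hp : ∀ v, p v = if v < D then v * x v else D) (v : ℝ) : p v ≤ v * x v := by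
  rw [hp, hx]
  split_ifs with h <;> linarith

lemma thresholdMechanism_nonneg (hD : 0 < D)
    (hx : ∀ v, x v = if v < D then (v / D) ^ a else 1) {v : ℝ} (hv : 0 ≤ v) : 0 ≤ x v := by
  rw [hx]
  split_ifs
  · exact Real.rpow_nonneg (div_nonneg hv hD.le) a
  · exact zero_le_one

lemma thresholdMechanism_IR (hM : 1 < M) (hD : 0 < D)
    (hx : ∀ v, x v = if v < D then (v / D) ^ a else 1)
    (hp : ∀ v, p v = if v < D then v * x v else D) : IR M V x p := by
  intro v hv
  have h1 := thresholdMechanism_payment_le hx hp v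
  have h2 : 0 ≤ (M - 1) * (v * x v) :=
    mul_nonneg (by linarith) (mul_nonneg hv.1 (thresholdMechanism_nonneg hD hx hv.1))
  rw [utility, if_pos h1]
  exact_mod_cast (by linarith : 0 ≤ M * v * x v - p v)

lemma thresholdMechanism_DSIC (ha : 0 < a) (hM : 1 < M) (haM : a * M = a + 1) (hD : 0 < D)
    (hx : ∀ v, x v = if v < D then (v / D) ^ a else 1)
    (hp : ∀ v, p v = if v < D then v * x v else D) : DSIC M V x p := by
  intro v hv b hb
  have hIR : IR M V x p := thresholdMechanism_IR hM hD hx hp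
  by_cases hf : p b ≤ v * x b
  swap
  · rw [utility, if_neg hf]
    exact bot_le
  have h1 := thresholdMechanism_payment_le hx hp v
  rcases hb.1.eq_or_lt with rfl | hb0
  · have hx0 : x 0 = 0 := by simp [hx, hD, ha.ne']
    have hp0 : p 0 = 0 := by simp [hp, hD]
    have : utility M x p 0 v = 0 := by simp [utility, hx0, hp0]
    rw [this]
    exact hIR v hv
  rw [utility, utility, if_pos hf, if_pos h1, EReal.coe_le_coe_iff]
  have hlt : ∀ w < D, 0 ≤ w → M * v * x w - p w = (M * v - w) * w ^ a * (D ^ a)⁻¹ := by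
    intro w hw hw0
    rw [hp, hx, if_pos hw, if_pos hw, Real.div_rpow hw0 hD.le]
    ring
  have hge : ∀ w, D ≤ w → M * v * x w - p w = (M * v - D) * D ^ a * (D ^ a)⁻¹ := by
    intro w hw
    have := (Real.rpow_pos_of_pos hD a).ne'
    rw [hp, hx, if_neg hw.not_gt, if_neg hw.not_gt]
    field_simp
  have hDa : 0 ≤ (D ^ a)⁻¹ := inv_nonneg.2 (Real.rpow_nonneg hD.le a)
  have hmono := monotoneOn_sub_mul_rpow ha haM v
  rcases lt_or_ge b D with hbD | hbD
  · have hxb : 0 < x b := by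
      rw [hx, if_pos hbD]
      exact Real.rpow_pos_of_pos (div_pos hb0 hD) a
    have hbv : b ≤ v := by
      rw [hp, if_pos hbD] at hf
      exact le_of_mul_le_mul_right hf hxb
    rw [hlt b hbD hb.1]
    rcases lt_or_ge v D with hvD | hvD
    · rw [hlt v hvD hv.1]
      exact mul_le_mul_of_nonneg_right (hmono ⟨hb.1, hbv⟩ ⟨hv.1, le_rfl⟩ hbv) hDa
    · rw [hge v hvD]
      exact mul_le_mul_of_nonneg_right (hmono ⟨hb.1, hbv⟩ ⟨hD.le, hvD⟩ hbD.le) hDa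
  · have hvD : D ≤ v := by
      rwa [hp, hx, if_neg hbD.not_gt, if_neg hbD.not_gt, mul_one] at hf
    rw [hge b hbD, hge v hvD]

end Mechanism

/-- Theorem 2: the optimal auction for a single ex post
ROI-constrained bidder with a DMR value distribution. With threshold `D` (given by
`∫₀^{D} ψ(v)·v^{1/(M−1)} dv = 0` if `∫₀^{v_max} ψ(v)·v^{1/(M−1)} dv > 0`, and
`D = v_max` otherwise), the mechanism `x*(v) = (v/D)^{1/(M−1)}`, `p*(v) = v·x*(v)`
for `v < D`, and `x*(v) = 1`, `p*(v) = D` for `v ≥ D`, is DSIC, IR, and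
revenue-maximizing among all DSIC and IR mechanisms. -/
theorem optimal_auction_single_bidder (vmax M : ℝ) (hvmax : 0 < vmax) (hM : 1 < M)
    (F f : ℝ → ℝ)
    (hf : ContinuousOn f (Set.Icc 0 vmax))
    (hfnonneg : ∀ v ∈ Set.Icc (0:ℝ) vmax, 0 ≤ f v)
    (hF : ∀ v ∈ Set.Icc (0:ℝ) vmax, F v = ∫ z in (0:ℝ)..v, f z)
    (hF1 : F vmax = 1)
    (hDMR : MonotoneOn (fun v => v * f v + F v - 1) (Set.Icc 0 vmax))
    (D : ℝ)
    (hDpos : 0 < (∫ v in (0:ℝ)..vmax, (v * f v + F v - 1) * v ^ ((1:ℝ) / (M - 1))) →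
      D ∈ Set.Ioo (0:ℝ) vmax ∧
        (∫ v in (0:ℝ)..D, (v * f v + F v - 1) * v ^ ((1:ℝ) / (M - 1))) = 0)
    (hDneg : (∫ v in (0:ℝ)..vmax, (v * f v + F v - 1) * v ^ ((1:ℝ) / (M - 1))) ≤ 0 →
      D = vmax)
    (xstar pstar : ℝ → ℝ)
    (hxstar : ∀ v, xstar v = if v < D then (v / D) ^ ((1:ℝ) / (M - 1)) else 1)
    (hpstar : ∀ v, pstar v = if v < D then v * xstar v else D) :
    DSIC M vmax xstar pstar ∧ IR M vmax xstar pstar ∧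
      ∀ x p : ℝ → ℝ, x 0 = 0 →
        (∀ v ∈ Set.Icc (0:ℝ) vmax, x v ∈ Set.Icc (0:ℝ) 1) →
        MonotoneOn x (Set.Icc 0 vmax) → RightDiffFin vmax x → p 0 = 0 →
        DSIC M vmax x p → IR M vmax x p →
        (∫ v in (0:ℝ)..vmax, p v * f v) ≤ ∫ v in (0:ℝ)..vmax, pstar v * f v := by
  set a : ℝ := 1 / (M - 1) with haDef
  have hM1 : 0 < M - 1 := by linarith
  have ha : 0 < a := div_pos one_pos hM1
  have haM : a * M = a + 1 := by rw [haDef]; field_simp; ring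
  -- `g` is a continuous, bounded, nonnegative extension of `f` to the whole line.
  set g : ℝ → ℝ := IccExtend hvmax.le ((Icc 0 vmax).domRestrict f)
  have hgc : Continuous g := hf.domRestrict.Icc_extend'
  have hgf : ∀ v ∈ Icc 0 vmax, g v = f v := fun v hv => IccExtend_of_mem hvmax.le _ hv
  have hg0 : ∀ v, 0 ≤ g v := fun v => hfnonneg _ (projIcc 0 vmax hvmax.le v).2
  obtain ⟨C, hC⟩ := isCompact_Icc.exists_bound_of_continuousOn hf
  have hgC : ∀ v, g v ≤ C := fun v =>
    (le_abs_self _).trans (hC _ (projIcc 0 vmax hvmax.le v).2)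
  have hG : ∀ v ∈ Icc 0 vmax, F v = ∫ z in (0:ℝ)..v, g z := by
    intro v hv
    rw [hF v hv]
    refine intervalIntegral.integral_congr fun z hz => (hgf z ?_).symm
    rw [uIcc_of_le hv.1] at hz
    exact ⟨hz.1, hz.2.trans hv.2⟩
  have hψ : EqOn (fun v => v * f v + F v - 1)
      (fun v => v * g v + (∫ t in (0:ℝ)..v, g t) - 1) (Icc 0 vmax) := by
    intro v hv
    simp only
    rw [hgf v hv, hG v hv]
  have hψK : ∀ v ∈ Icc 0 vmax, ∫ z in (0:ℝ)..v, (z * f z + F z - 1) * z ^ a =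
      ∫ z in (0:ℝ)..v, (z * g z + (∫ t in (0:ℝ)..z, g t) - 1) * z ^ a := by
    intro v hv
    refine intervalIntegral.integral_congr fun z hz => ?_
    rw [uIcc_of_le hv.1] at hz
    exact congrArg (· * z ^ a) (hψ ⟨hz.1, hz.2.trans hv.2⟩)
  have hvm : vmax ∈ Icc 0 vmax := ⟨hvmax.le, le_rfl⟩
  have hG1 : ∫ z in (0:ℝ)..vmax, g z = 1 := by rw [← hG vmax hvm, hF1]
  have hDprop : 0 < D ∧ D ≤ vmax ∧
      ∫ z in (0:ℝ)..D, (z * f z + F z - 1) * z ^ a = 0 := by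
    rcases lt_or_ge 0 (∫ v in (0:ℝ)..vmax, (v * f v + F v - 1) * v ^ a) with h | h
    · obtain ⟨h1, h2⟩ := hDpos h
      exact ⟨h1.1, h1.2.le, h2⟩
    · rw [hDneg h]
      refine ⟨hvmax, le_rfl, le_antisymm h ?_⟩
      have h1 := integral_virtualValue_mul_rpow ha rfl hgc hvmax.le
      rw [← hψK vmax hvm, hG1, sub_self, mul_zero, zero_add] at h1
      have h2 : 0 ≤ ∫ z in (0:ℝ)..vmax, z ^ (a + 1) * g z :=
        intervalIntegral.integral_nonneg hvmax.le fun z hz =>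
          mul_nonneg (Real.rpow_nonneg hz.1 _) (hg0 z)
      exact nonneg_of_mul_nonneg_right (h1 ▸ mul_nonneg ha.le h2) (by linarith)
  obtain ⟨hD0, hDV, hK⟩ := hDprop
  rw [hψK D ⟨hD0.le, hDV⟩] at hK
  refine ⟨thresholdMechanism_DSIC ha hM haM hD0 hxstar hpstar,
    thresholdMechanism_IR hM hD0 hxstar hpstar, ?_⟩
  intro x p _ hx01 hx _ _ hDSIC hIR
  have hrev : ∀ r : ℝ → ℝ,
      ∫ v in (0:ℝ)..vmax, r v * f v = ∫ v in (0:ℝ)..vmax, r v * g v := by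
    intro r
    refine intervalIntegral.integral_congr fun z hz => ?_
    rw [uIcc_of_le hvmax.le] at hz
    simp only [hgf z hz]
  rw [hrev, hrev, integral_optimal_payment (p := pstar) ha rfl haM hgc hD0 hDV hG1 hK
    (fun v hv => by rw [hpstar, hxstar, if_pos hv, if_pos hv])
    (fun v hv => by rw [hpstar, if_neg hv.not_gt])]
  exact integral_payment_le ha rfl haM hgc hg0 hgC hD0 hDV hG1 (hDMR.congr hψ) hK hx hx01
    (fun v hv => payment_le_of_IR hIR hv) fun b v hb hbv hv =>
      utility_le_of_DSIC hDSIC hIR ⟨hb, hbv.trans hv⟩ ⟨hb.trans hbv, hv⟩ hbv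
        (hx01 b ⟨hb, hbv.trans hv⟩).1
end

section
/- Let M > 1, v_max > 0, and let ψ : [0, v_max] → ℝ be continuous and monotonically non-decreasing with ψ(0) = −1 and ψ(v_max) > 0, and suppose ∫₀^{v_max} ψ(v)·v^{1/(M−1)} dv > 0. Then there exists a unique D* ∈ (0, v_max) such that ∫₀^{D*} ψ(v)·v^{1/(M−1)} dv = 0; moreover, the function rev(D) = ∫₀^D ψ(v)·(v/D)^{1/(M−1)} dv + ∫_D^{v_max} ψ(v) dv is non-decreasing on (0, D*] and non-increasing on [D*, v_max], so rev attains its maximum over (0, v_max] at D = D*. -/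
open Set MeasureTheory

/-- Expected revenue, as a function of the threshold `D`, of the single-bidder
mechanism with allocation `x(v) = (v/D)^{1/(M−1)}` for `v ≤ D` and `x(v) = 1` for
`v > D`, expressed via the marginal revenue `ψ(v) = v·f(v) + F(v) − 1`. -/
noncomputable def thresholdRev (M vmax : ℝ) (ψ : ℝ → ℝ) (D : ℝ) : ℝ :=
  (∫ v in (0:ℝ)..D, ψ v * (v / D) ^ ((1:ℝ) / (M - 1))) + ∫ v in D..vmax, ψ v

/-- A single-crossing property: if `ψ` is non-decreasing and negative at `0`, and `w` is positive
on `(0, ∞)`, then a primitive of `ψ * w` that has become non-negative is positive afterwards. -/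
theorem integral_mul_pos_of_integral_mul_nonneg {b : ℝ} {ψ w : ℝ → ℝ}
    (hψ : ContinuousOn ψ (Icc 0 b)) (hw : ContinuousOn w (Icc 0 b)) (hmono : MonotoneOn ψ (Icc 0 b))
    (hwpos : ∀ v, 0 < v → 0 < w v) (hneg : ∀ D ∈ Ioc 0 b, ψ D ≤ 0 → ∫ v in (0:ℝ)..D, ψ v * w v < 0)
    {D E : ℝ} (hD : 0 < D) (hDE : D < E) (hE : E ≤ b) (h : 0 ≤ ∫ v in (0:ℝ)..D, ψ v * w v) :
    0 < ∫ v in (0:ℝ)..E, ψ v * w v := by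
  have hψD : 0 < ψ D := by
    by_contra! hle
    exact absurd (hneg D ⟨hD, by linarith⟩ hle) (not_lt.mpr h)
  have hc : ContinuousOn (fun v => ψ v * w v) (Icc 0 b) := hψ.mul hw
  have hii : ∀ x y, 0 ≤ x → x ≤ y → y ≤ b →
      IntervalIntegrable (fun v => ψ v * w v) volume x y := fun x y hx hxy hy =>
    (hc.mono (Icc_subset_Icc hx hy)).intervalIntegrable_of_Icc hxy
  rw [← intervalIntegral.integral_add_adjacent_intervals (hii 0 D le_rfl hD.le (by linarith))
    (hii D E hD.le hDE.le hE)]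
  have hpos : 0 < ∫ v in D..E, ψ v * w v := by
    refine intervalIntegral.intervalIntegral_pos_of_pos_on (hii D E hD.le hDE.le hE) ?_ hDE
    intro v hv
    have := hmono ⟨hD.le, by linarith⟩ ⟨by linarith [hv.1], by linarith [hv.2]⟩ hv.1.le
    exact mul_pos (hψD.trans_le this) (hwpos v (hD.trans hv.1))
  linarith

/-- A non-decreasing continuous function that is negative at `0` has negative weighted integral
over `[0, D]` as long as it is non-positive at `D`. -/
theorem integral_mul_neg_of_nonpos {b : ℝ} {ψ w : ℝ → ℝ}
    (hψ : ContinuousOn ψ (Icc 0 b)) (hw : ContinuousOn w (Icc 0 b)) (hmono : MonotoneOn ψ (Icc 0 b))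
    (hwpos : ∀ v, 0 < v → 0 < w v) {ε : ℝ} (hε : 0 < ε) (hψε : ∀ v ∈ Icc 0 ε, ψ v < 0)
    {D : ℝ} (hD : D ∈ Ioc 0 b) (h : ψ D ≤ 0) : ∫ v in (0:ℝ)..D, ψ v * w v < 0 := by
  have hsub : Icc 0 D ⊆ Icc 0 b := Icc_subset_Icc le_rfl hD.2
  have hlt := intervalIntegral.integral_lt_integral_of_continuousOn_of_le_of_exists_lt
    (f := fun v => ψ v * w v) (g := fun _ => (0:ℝ)) hD.1 ((hψ.mul hw).mono hsub)
    continuousOn_const ?_ ?_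
  · simpa using hlt
  · intro v hv
    have := hmono (hsub ⟨hv.1.le, hv.2⟩) ⟨hD.1.le, hD.2⟩ hv.2
    exact mul_nonpos_of_nonpos_of_nonneg (this.trans h) (hwpos v hv.1).le
  · have hmin : 0 < min ε D := lt_min hε hD.1
    exact ⟨min ε D, ⟨hmin.le, min_le_right _ _⟩,
      mul_neg_of_neg_of_pos (hψε _ ⟨hmin.le, min_le_left _ _⟩) (hwpos _ hmin)⟩

theorem thresholdRev_eq {M D : ℝ} (vmax : ℝ) (ψ : ℝ → ℝ) (hD : 0 < D) :
    thresholdRev M vmax ψ D =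
      D ^ (-(1 / (M - 1))) * (∫ v in (0:ℝ)..D, ψ v * v ^ ((1:ℝ) / (M - 1))) +
        ∫ v in D..vmax, ψ v := by
  rw [thresholdRev, ← intervalIntegral.integral_const_mul]
  congr 1
  refine intervalIntegral.integral_congr fun v hv => ?_
  rw [uIcc_of_le hD.le] at hv
  simp only [Real.div_rpow hv.1 hD.le, Real.rpow_neg hD.le]
  ring

theorem continuousOn_thresholdRev {M vmax : ℝ} {ψ : ℝ → ℝ} (hM : 1 < M)
    (hcont : ContinuousOn ψ (Icc 0 vmax)) :
    ContinuousOn (thresholdRev M vmax ψ) (Ioc 0 vmax) := by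
  rcases le_or_gt vmax 0 with hv | hv
  · simp [Ioc_eq_empty hv.not_gt]
  have hsub : Ioc 0 vmax ⊆ uIcc 0 vmax := by
    rw [uIcc_of_le hv.le]; exact Ioc_subset_Icc_self
  have ha : 0 ≤ 1 / (M - 1) := by have := sub_pos.mpr hM; positivity
  have hg : ContinuousOn (fun v => ψ v * v ^ ((1:ℝ) / (M - 1))) (Icc 0 vmax) :=
    hcont.mul (Real.continuous_rpow_const ha).continuousOn
  have hG := (intervalIntegral.continuousOn_primitive_interval (μ := volume)
    (by rw [uIcc_of_le hv.le]; exact hg.integrableOn_Icc)).mono hsub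
  have hH := (intervalIntegral.continuousOn_primitive_interval_left (μ := volume)
    (by rw [uIcc_of_le hv.le]; exact hcont.integrableOn_Icc)).mono hsub
  refine ContinuousOn.congr (((continuousOn_id.rpow_const fun x hx => Or.inl hx.1.ne').mul hG).add
    hH) fun D hD => thresholdRev_eq vmax ψ hD.1

theorem hasDerivAt_thresholdRev {M vmax D : ℝ} {ψ : ℝ → ℝ} (hM : 1 < M)
    (hcont : ContinuousOn ψ (Icc 0 vmax)) (hD : D ∈ Ioo 0 vmax) :
    HasDerivAt (thresholdRev M vmax ψ)
      (-(1 / (M - 1)) * D ^ (-(1 / (M - 1)) - 1) *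
        ∫ v in (0:ℝ)..D, ψ v * v ^ ((1:ℝ) / (M - 1))) D := by
  have ha : 0 ≤ 1 / (M - 1) := by have := sub_pos.mpr hM; positivity
  have hg : ContinuousOn (fun v => ψ v * v ^ ((1:ℝ) / (M - 1))) (Icc 0 vmax) :=
    hcont.mul (Real.continuous_rpow_const ha).continuousOn
  have hnhds : Icc 0 vmax ∈ nhds D := Icc_mem_nhds hD.1 hD.2
  have hG := intervalIntegral.integral_hasDerivAt_right
    ((hg.mono (Icc_subset_Icc le_rfl hD.2.le)).intervalIntegrable_of_Icc (μ := volume) hD.1.le)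
    ((hg.mono Ioo_subset_Icc_self).stronglyMeasurableAtFilter isOpen_Ioo D hD)
    (hg.continuousAt hnhds)
  have hH := intervalIntegral.integral_hasDerivAt_left
    ((hcont.mono (Icc_subset_Icc hD.1.le le_rfl)).intervalIntegrable_of_Icc (μ := volume) hD.2.le)
    ((hcont.mono Ioo_subset_Icc_self).stronglyMeasurableAtFilter isOpen_Ioo D hD)
    (hcont.continuousAt hnhds)
  have hp := Real.hasDerivAt_rpow_const (x := D) (p := -(1 / (M - 1))) (Or.inl hD.1.ne')
  have hcancel : D ^ (-(1 / (M - 1))) * D ^ (1 / (M - 1)) = 1 := by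
    rw [← Real.rpow_add hD.1, neg_add_cancel, Real.rpow_zero]
  refine (((hp.mul hG).add hH).congr_of_eventuallyEq ?_).congr_deriv ?_
  · filter_upwards [Ioi_mem_nhds hD.1] with x hx using thresholdRev_eq vmax ψ hx
  · linear_combination ψ D * hcancel

/-- under the DMR condition (ψ non-decreasing, ψ(0) = −1,
ψ(v_max) > 0), if `∫₀^{v_max} ψ(v)·v^{1/(M−1)} dv > 0` then there is a unique
`D* ∈ (0, v_max)` with `∫₀^{D*} ψ(v)·v^{1/(M−1)} dv = 0`; the threshold revenue is
non-decreasing on `(0, D*]`, non-increasing on `[D*, v_max]`, and is maximized over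
`(0, v_max]` at `D*`. -/
theorem thresholdRev_max_at_Dstar (M vmax : ℝ) (hM : 1 < M) (hvmax : 0 < vmax)
    (ψ : ℝ → ℝ)
    (hcont : ContinuousOn ψ (Set.Icc 0 vmax))
    (hmono : MonotoneOn ψ (Set.Icc 0 vmax))
    (hψ0 : ψ 0 = -1) (hψmax : 0 < ψ vmax)
    (hint : 0 < ∫ v in (0:ℝ)..vmax, ψ v * v ^ ((1:ℝ) / (M - 1))) :
    ∃ Dstar ∈ Set.Ioo (0:ℝ) vmax,
      (∫ v in (0:ℝ)..Dstar, ψ v * v ^ ((1:ℝ) / (M - 1))) = 0 ∧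
      (∀ D ∈ Set.Ioo (0:ℝ) vmax,
        (∫ v in (0:ℝ)..D, ψ v * v ^ ((1:ℝ) / (M - 1))) = 0 → D = Dstar) ∧
      MonotoneOn (thresholdRev M vmax ψ) (Set.Ioc 0 Dstar) ∧
      AntitoneOn (thresholdRev M vmax ψ) (Set.Icc Dstar vmax) ∧
      ∀ D ∈ Set.Ioc (0:ℝ) vmax, thresholdRev M vmax ψ D ≤ thresholdRev M vmax ψ Dstar := by
  have hM' : 0 < M - 1 := sub_pos.mpr hM
  have hw : Continuous fun v : ℝ => v ^ ((1:ℝ) / (M - 1)) :=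
    Real.continuous_rpow_const (by positivity)
  have hwpos : ∀ v : ℝ, 0 < v → 0 < v ^ ((1:ℝ) / (M - 1)) := fun v hv => Real.rpow_pos_of_pos hv _
  obtain ⟨ε, hε, hψε⟩ : ∃ ε ∈ Ioo 0 vmax, ∀ v ∈ Icc 0 ε, ψ v < 0 := by
    have h0 : ∀ᶠ v in nhdsWithin 0 (Icc 0 vmax), ψ v < 0 :=
      (hcont 0 ⟨le_rfl, hvmax.le⟩).eventually_lt_const (by rw [hψ0]; norm_num)
    have h1 : ∀ᶠ v in nhdsWithin 0 (Ioi 0), ψ v < 0 := by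
      rw [← nhdsWithin_Ioo_eq_nhdsGT hvmax]
      exact h0.filter_mono (nhdsWithin_mono _ Ioo_subset_Icc_self)
    obtain ⟨ε, hψε, hε⟩ := (h1.and (Ioo_mem_nhdsGT hvmax)).exists
    exact ⟨ε, hε, fun v hv => (hmono ⟨hv.1, hv.2.trans hε.2.le⟩ ⟨hε.1.le, hε.2.le⟩ hv.2).trans_lt
      hψε⟩
  set G : ℝ → ℝ := fun D => ∫ v in (0:ℝ)..D, ψ v * v ^ ((1:ℝ) / (M - 1)) with hG
  have hneg : ∀ D ∈ Ioc 0 vmax, ψ D ≤ 0 → G D < 0 := fun D hD h =>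
    integral_mul_neg_of_nonpos hcont hw.continuousOn hmono hwpos hε.1 hψε hD h
  have hcross : ∀ D E, 0 < D → D < E → E ≤ vmax → 0 ≤ G D → 0 < G E := fun D E hD hDE hE h =>
    integral_mul_pos_of_integral_mul_nonneg hcont hw.continuousOn hmono hwpos hneg hD hDE hE h
  have hGcont : ContinuousOn G (Icc 0 vmax) := by
    have := intervalIntegral.continuousOn_primitive_interval (μ := volume) (a := 0) (b := vmax)
      (f := fun v => ψ v * v ^ ((1:ℝ) / (M - 1)))
      (by rw [uIcc_of_le hvmax.le]; exact (hcont.mul hw.continuousOn).integrableOn_Icc)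
    rwa [uIcc_of_le hvmax.le] at this
  obtain ⟨D₀, hD₀, hzero⟩ := intermediate_value_Ioo hε.2.le
    (hGcont.mono (Icc_subset_Icc hε.1.le le_rfl))
    (show (0:ℝ) ∈ Ioo (G ε) (G vmax) from
      ⟨hneg ε ⟨hε.1, hε.2.le⟩ (hψε ε ⟨hε.1.le, le_rfl⟩).le, hint⟩)
  have hD₀pos : 0 < D₀ := hε.1.trans hD₀.1
  have hbefore : ∀ D, 0 < D → D < D₀ → G D < 0 := fun D hD hlt => by
    by_contra! h
    exact (hcross D D₀ hD hlt hD₀.2.le h).ne' hzero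
  have hafter : ∀ D, D₀ < D → D ≤ vmax → 0 < G D := fun D hlt hD =>
    hcross D₀ D hD₀pos hlt hD hzero.ge
  have hrev := continuousOn_thresholdRev hM hcont
  have hleft : MonotoneOn (thresholdRev M vmax ψ) (Ioc 0 D₀) := by
    refine monotoneOn_of_deriv_nonneg (convex_Ioc 0 D₀)
      (hrev.mono (Ioc_subset_Ioc le_rfl hD₀.2.le)) ?_ ?_ <;>
      intro D hD <;> rw [interior_Ioc] at hD
    · exact (hasDerivAt_thresholdRev hM hcont
        ⟨hD.1, hD.2.trans hD₀.2⟩).differentiableAt.differentiableWithinAt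
    · rw [(hasDerivAt_thresholdRev hM hcont ⟨hD.1, hD.2.trans hD₀.2⟩).deriv]
      refine mul_nonneg_of_nonpos_of_nonpos ?_ (hbefore D hD.1 hD.2).le
      have := Real.rpow_pos_of_pos hD.1 (-(1 / (M - 1)) - 1)
      exact mul_nonpos_of_nonpos_of_nonneg (neg_nonpos.mpr (by positivity)) this.le
  have hright : AntitoneOn (thresholdRev M vmax ψ) (Icc D₀ vmax) := by
    refine antitoneOn_of_deriv_nonpos (convex_Icc D₀ vmax)
      (hrev.mono fun D hD => ⟨hD₀pos.trans_le hD.1, hD.2⟩) ?_ ?_ <;>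
      intro D hD <;> rw [interior_Icc] at hD
    · exact (hasDerivAt_thresholdRev hM hcont
        ⟨hD₀pos.trans hD.1, hD.2⟩).differentiableAt.differentiableWithinAt
    · rw [(hasDerivAt_thresholdRev hM hcont ⟨hD₀pos.trans hD.1, hD.2⟩).deriv]
      refine mul_nonpos_of_nonpos_of_nonneg ?_ (hafter D hD.1 hD.2.le).le
      have := Real.rpow_pos_of_pos (hD₀pos.trans hD.1) (-(1 / (M - 1)) - 1)
      exact mul_nonpos_of_nonpos_of_nonneg (neg_nonpos.mpr (by positivity)) this.le
  refine ⟨D₀, ⟨hD₀pos, hD₀.2⟩, hzero, fun D hD h => ?_, hleft, hright, fun D hD => ?_⟩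
  · rcases lt_trichotomy D D₀ with hlt | heq | hgt
    · exact absurd h (hbefore D hD.1 hlt).ne
    · exact heq
    · exact absurd h (hafter D hgt hD.2.le).ne'
  · rcases le_total D D₀ with hle | hge
    · exact hleft ⟨hD.1, hle⟩ ⟨hD₀pos, le_rfl⟩ hle
    · exact hright ⟨le_rfl, hD₀.2.le⟩ ⟨hge, hD.2⟩ hge
end

section
/- If a mechanism (x, p) for a single ex post ROI-constrained bidder is DSIC and IR, then for all values v, v' ∈ [0, v_max] with v < v', the inequality M·v'·x(v) − p(v) ≤ M·v'·x(v') − p(v') holds (i.e. the IR constraint is never binding for a downward misreport, so the standard incentive inequality for type v' misreporting v must hold). -/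
open Set MeasureTheory

/-- A finite lower bound on the utility forces the ROI condition. -/
theorem le_mul_of_zero_le_utility {M : ℝ} {x p : ℝ → ℝ} {b v : ℝ}
    (h : (0 : EReal) ≤ utility M x p b v) : p b ≤ v * x b := by
  by_contra hb
  simp [utility, hb] at h

/-- in a DSIC and IR mechanism, for any values `v < v'`, the
standard incentive inequality for type `v'` misreporting `v` holds (the IR
constraint is never binding for a downward misreport). -/
theorem downward_incentive_inequality (vmax M : ℝ) (hvmax : 0 < vmax) (hM : 1 < M)
    (x p : ℝ → ℝ)
    (hx0 : x 0 = 0) (hxrange : ∀ v ∈ Set.Icc (0:ℝ) vmax, x v ∈ Set.Icc (0:ℝ) 1)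
    (hp0 : p 0 = 0)
    (hdsic : DSIC M vmax x p) (hir : IR M vmax x p) :
    ∀ v ∈ Set.Icc (0:ℝ) vmax, ∀ v' ∈ Set.Icc (0:ℝ) vmax, v < v' →
      M * v' * x v - p v ≤ M * v' * x v' - p v' := by
  intro v hv v' hv' hlt
  have truthful : p v ≤ v * x v := le_mul_of_zero_le_utility (hir v hv)
  have truthful' : p v' ≤ v' * x v' := le_mul_of_zero_le_utility (hir v' hv')
  have misreport : p v ≤ v' * x v :=
    truthful.trans (mul_le_mul_of_nonneg_right hlt.le (hxrange v hv).1)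
  have h := hdsic v' hv' v hv
  rw [utility, utility, if_pos misreport, if_pos truthful'] at h
  exact EReal.coe_le_coe_iff.mp h
end

section
/- For a single bidder with value uniformly distributed on [0, 1] and ROI parameter M = 2: the mechanism with allocation x(v) = (4/3)·v for v ≤ 3/4 and x(v) = 1 for v > 3/4, and payment p(v) = v·x(v) for v ≤ 3/4 and p(v) = 3/4 for v > 3/4, is DSIC and IR and has expected revenue ∫₀¹ p(v) dv = 3/8; in contrast, the posted-price mechanism with x(v) = 0, p(v) = 0 for v < 1/2 and x(v) = 1, p(v) = 1/2 for v ≥ 1/2 has expected revenue 1/4. -/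
open Set MeasureTheory

/-- The integral of a function that agrees with `g` on `(a, b)` and with `h` on `(b, c)`. -/
theorem integral_eq_add_of_eqOn_Ioo {f g h : ℝ → ℝ} {a b c : ℝ} (hab : a ≤ b) (hbc : b ≤ c)
    (hg : Continuous g) (hh : Continuous h)
    (hfg : Set.EqOn f g (Set.Ioo a b)) (hfh : Set.EqOn f h (Set.Ioo b c)) :
    (∫ v in a..c, f v) = (∫ v in a..b, g v) + ∫ v in b..c, h v := by
  have hfg' : Set.EqOn g f (Set.uIoo a b) := by
    rw [Set.uIoo_of_le hab]; exact hfg.symm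
  have hfh' : Set.EqOn h f (Set.uIoo b c) := by
    rw [Set.uIoo_of_le hbc]; exact hfh.symm
  rw [← intervalIntegral.integral_add_adjacent_intervals
      ((hg.intervalIntegrable a b).congr_uIoo hfg')
      ((hh.intervalIntegrable b c).congr_uIoo hfh'),
    intervalIntegral.integral_congr_uIoo hfg', intervalIntegral.integral_congr_uIoo hfh']

/-- DSIC follows if truthful reports satisfy the ROI condition and no other report satisfying it
yields a larger payoff. -/
theorem DSIC.of_forall_le {M vmax : ℝ} {x p : ℝ → ℝ}
    (hir : ∀ v ∈ Set.Icc (0:ℝ) vmax, p v ≤ v * x v)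
    (hic : ∀ v ∈ Set.Icc (0:ℝ) vmax, ∀ b ∈ Set.Icc (0:ℝ) vmax, p b ≤ v * x b →
      M * v * x b - p b ≤ M * v * x v - p v) :
    DSIC M vmax x p := by
  intro v hv b hb
  unfold utility
  rw [if_pos (hir v hv)]
  split_ifs with h
  · exact EReal.coe_le_coe_iff.2 (hic v hv b hb h)
  · exact bot_le

/-- IR follows if truthful reports satisfy the ROI condition and `x` is nonnegative. -/
theorem IR.of_forall_le {M vmax : ℝ} {x p : ℝ → ℝ} (hM : 1 ≤ M)
    (hx : ∀ v ∈ Set.Icc (0:ℝ) vmax, 0 ≤ x v)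
    (hir : ∀ v ∈ Set.Icc (0:ℝ) vmax, p v ≤ v * x v) :
    IR M vmax x p := by
  intro v hv
  unfold utility
  rw [if_pos (hir v hv)]
  refine EReal.coe_nonneg.2 ?_
  nlinarith [hir v hv, mul_nonneg (sub_nonneg.2 hM) (mul_nonneg hv.1 (hx v hv))]

/-- Example 1: for a single bidder with value uniform on `[0,1]`
and ROI parameter `M = 2`, the randomized mechanism with `x(v) = (4/3)·v`,
`p(v) = v·x(v)` for `v ≤ 3/4` and `x(v) = 1`, `p(v) = 3/4` for `v > 3/4` is DSIC
and IR with expected revenue `3/8`, while the posted-price mechanism at price `1/2`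
has expected revenue `1/4`. -/
theorem uniform_example (x p x2 p2 : ℝ → ℝ)
    (hx : ∀ v, x v = if v ≤ 3/4 then (4/3) * v else 1)
    (hp : ∀ v, p v = if v ≤ 3/4 then v * x v else 3/4)
    (hx2 : ∀ v, x2 v = if v < 1/2 then 0 else 1)
    (hp2 : ∀ v, p2 v = if v < 1/2 then 0 else 1/2) :
    DSIC 2 1 x p ∧ IR 2 1 x p ∧
      (∫ v in (0:ℝ)..1, p v) = 3/8 ∧ (∫ v in (0:ℝ)..1, p2 v) = 1/4 := by
  have hir : ∀ v ∈ Set.Icc (0:ℝ) 1, p v ≤ v * x v := by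
    intro v _
    rw [hp, hx]
    split_ifs <;> linarith
  refine ⟨DSIC.of_forall_le hir ?_, IR.of_forall_le (by norm_num) ?_ hir, ?_, ?_⟩
  · rintro v ⟨hv0, hv1⟩ b ⟨hb0, hb1⟩ h
    rw [hp, hx] at h ⊢
    rw [hp v, hx v]
    split_ifs at h ⊢ with hb hv hv
    · nlinarith [sq_nonneg (v - b)]
    · nlinarith [mul_nonneg (sub_nonneg.2 hb) (by linarith : (0:ℝ) ≤ 2 * v - b - 3 / 4)]
    · nlinarith
    · linarith
  · rintro v ⟨hv0, hv1⟩
    rw [hx]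
    split_ifs <;> linarith
  · rw [integral_eq_add_of_eqOn_Ioo (b := 3 / 4) (g := fun v => (4 / 3) * v ^ 2)
      (h := fun _ => 3 / 4) (by norm_num) (by norm_num) (by fun_prop) (by fun_prop)]
    · rw [intervalIntegral.integral_const_mul, integral_pow, intervalIntegral.integral_const]
      norm_num
    · intro v hv
      simp only [hp, hx, if_pos hv.2.le]
      ring
    · intro v hv
      simp only [hp, if_neg (not_le.2 hv.1)]
  · rw [integral_eq_add_of_eqOn_Ioo (b := 1 / 2) (g := fun _ => 0)
      (h := fun _ => 1 / 2) (by norm_num) (by norm_num) (by fun_prop) (by fun_prop)]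
    · rw [intervalIntegral.integral_const, intervalIntegral.integral_const]
      norm_num
    · intro v hv
      simp only [hp2, if_pos hv.2]
    · intro v hv
      simp only [hp2, if_neg (not_lt.2 hv.1.le)]
end
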